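/- arXiv:2202.09575 — 2 statements merged into one kernel-verified Lean document; each statement's English description precedes it below -/
import Mathlib

section
/- Let W be an xy-symmetric weight function on a measurable set Ω ⊆ ℝ² and {Sₙ} the MOPS of W, with invertible Gram matrices 𝐒ₙ = ∫_Ω Sₙ Sₙᵀ W dx dy, and set Γ_{n,k} = 𝐒ₙ L_{n−1,k}ᵀ 𝐒_{n−1}⁻¹ for n ≥ 1, k ∈ {1,2}. Suppose q_{n,k} are real bivariate polynomials with S_{2n+2,2k+1}(x,y) = x·y·q_{n,k}(x²,y²) (0 ≤ k ≤ n), set Q̂ₙ = (q_{n,0},…,q_{n,n})ᵀ, and assume the Gram matrices 𝐐̂ₙ = ∫_{Ω*} Q̂ₙ Q̂ₙᵀ W^{(1,1)} du dv are invertible. Then for all n ≥ 0 and k ∈ {1,2} (u₁ = u, u₂ = v): (∫_{Ω*} u_k·Q̂ₙ Q̂ₙᵀ W^{(1,1)} du dv)·𝐐̂ₙ⁻¹ = J_n^{(1,1)}[L_{2n+2,k}Γ_{2n+3,k} + Γ_{2n+2,k}L_{2n+1,k}](J_n^{(1,1)})ᵀ, and for n ≥ 1: 𝐐̂ₙ L_{n−1,k}ᵀ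 𝐐̂_{n−1}⁻¹ = J_n^{(1,1)} Γ_{2n+2,k} Γ_{2n+1,k} (J_{n−1}^{(1,1)})ᵀ. -/
noncomputable section

open MeasureTheory MvPolynomial

/-- Evaluation of a bivariate polynomial at a point of `ℝ × ℝ`. -/
def ev (p : ℝ × ℝ) (f : MvPolynomial (Fin 2) ℝ) : ℝ := eval ![p.1, p.2] f

/-- `W` is a weight function on the measurable set `Ω ⊆ ℝ²`: nonnegative and measurable,
positive on a set of positive Lebesgue measure, with all moments finite. -/
def IsWeight (Ω : Set (ℝ × ℝ)) (W : ℝ × ℝ → ℝ) : Prop :=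
  MeasurableSet Ω ∧ Measurable W ∧ (∀ p ∈ Ω, 0 ≤ W p) ∧
    0 < volume {p | p ∈ Ω ∧ 0 < W p} ∧
    ∀ h k : ℕ, IntegrableOn (fun p : ℝ × ℝ => p.1 ^ h * p.2 ^ k * W p) Ω

/-- `W` is an `xy`-symmetric weight on `Ω`: `Ω` is invariant under `(x,y) ↦ (-x,y)` and
`(x,y) ↦ (x,-y)`, and `W(-x,y) = W(x,y) = W(x,-y)` on `Ω`. -/
def XYSymmetric (Ω : Set (ℝ × ℝ)) (W : ℝ × ℝ → ℝ) : Prop :=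
  (∀ p : ℝ × ℝ, p ∈ Ω → (-p.1, p.2) ∈ Ω ∧ (p.1, -p.2) ∈ Ω) ∧
    ∀ p ∈ Ω, W (-p.1, p.2) = W p ∧ W (p.1, -p.2) = W p

/-- `f` is monic of the form `x^(n-j) y^j + (terms of total degree < n)`. -/
def MonicLead (n j : ℕ) (f : MvPolynomial (Fin 2) ℝ) : Prop :=
  f = X 0 ^ (n - j) * X 1 ^ j ∨ (f - X 0 ^ (n - j) * X 1 ^ j).totalDegree < n

/-- `P` is the monic orthogonal polynomial system (MOPS) of the weight `W` on `Ω`: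
each `P n j` is monic with leading term `x^(n-j) y^j`, and vectors of different degrees
are mutually orthogonal. -/
def IsMOPS (Ω : Set (ℝ × ℝ)) (W : ℝ × ℝ → ℝ)
    (P : (n : ℕ) → Fin (n + 1) → MvPolynomial (Fin 2) ℝ) : Prop :=
  (∀ (n : ℕ) (j : Fin (n + 1)), MonicLead n (j : ℕ) (P n j)) ∧
    ∀ m n : ℕ, m ≠ n → ∀ (i : Fin (m + 1)) (j : Fin (n + 1)),
      ∫ p in Ω, ev p (P m i) * ev p (P n j) * W p = 0

/-- The image domain `Ω* = {(u,v) : u ≥ 0, v ≥ 0, (√u, √v) ∈ Ω}`. -/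
def Ωstar (Ω : Set (ℝ × ℝ)) : Set (ℝ × ℝ) :=
  {q | 0 ≤ q.1 ∧ 0 ≤ q.2 ∧ (Real.sqrt q.1, Real.sqrt q.2) ∈ Ω}

/-- The weight `W^(0,0)(u,v) = (1/4) (uv)^(-1/2) W(√u, √v)` on `Ω*`. -/
def W00 (W : ℝ × ℝ → ℝ) : ℝ × ℝ → ℝ :=
  fun q => (1 / 4) * W (Real.sqrt q.1, Real.sqrt q.2) / Real.sqrt (q.1 * q.2)

open Matrix in
/-- `Lmat n k` is the `(n+1) × (n+2)` matrix `L_{n,k}` (for `k = 1, 2`). -/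
def Lmat (n k : ℕ) : Matrix (Fin (n + 1)) (Fin (n + 2)) ℝ :=
  Matrix.of fun h m => if (m : ℕ) = (h : ℕ) + (k - 1) then 1 else 0

/-- `Jmat r c j` is the `r × c` matrix whose `(h, m)` entry is `1` iff `m = 2h + j`;
`J_n^(i,j)` is `Jmat (n+1) (2*n+1+i+j) j`. -/
def Jmat (r c j : ℕ) : Matrix (Fin r) (Fin c) ℝ :=
  Matrix.of fun h m => if (m : ℕ) = 2 * (h : ℕ) + j then 1 else 0

/-- The span of the bivariate monomials of total degree less than `n`. -/
def lowDeg (n : ℕ) : Submodule ℝ (MvPolynomial (Fin 2) ℝ) :=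
  Submodule.span ℝ {f | ∃ a b : ℕ, a + b < n ∧ f = X 0 ^ a * X 1 ^ b}

lemma lowDeg_mono {m n : ℕ} (h : m ≤ n) : lowDeg m ≤ lowDeg n := by
  apply Submodule.span_mono
  rintro f ⟨a, b, hab, rfl⟩
  exact ⟨a, b, by omega, rfl⟩

lemma monomial_mem_lowDeg {a b n : ℕ} (h : a + b < n) :
    (X 0 ^ a * X 1 ^ b : MvPolynomial (Fin 2) ℝ) ∈ lowDeg n :=
  Submodule.subset_span ⟨a, b, h, rfl⟩

lemma mem_lowDeg_of_totalDegree_lt {n : ℕ} {f : MvPolynomial (Fin 2) ℝ}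
    (h : f.totalDegree < n) : f ∈ lowDeg n := by
  rw [f.as_sum]
  refine Submodule.sum_mem _ fun d hd => ?_
  have h1 := le_totalDegree hd
  rw [Finsupp.sum_fintype _ _ (by simp), Fin.sum_univ_two] at h1
  have h2 : monomial d (coeff d f) = coeff d f • (X 0 ^ d 0 * X 1 ^ d 1) := by
    rw [monomial_eq, Finsupp.prod_fintype _ _ (by simp), Fin.prod_univ_two, smul_eq_C_mul]
  rw [h2]
  exact Submodule.smul_mem _ _ (monomial_mem_lowDeg (by omega))

lemma X_mul_mem_lowDeg {n : ℕ} {f : MvPolynomial (Fin 2) ℝ} (c : Fin 2) (h : f ∈ lowDeg n) :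
    X c * f ∈ lowDeg (n + 1) := by
  induction h using Submodule.span_induction with
  | mem f hf =>
    obtain ⟨a, b, hab, rfl⟩ := hf
    fin_cases c
    · convert monomial_mem_lowDeg (a := a + 1) (b := b) (n := n + 1) (by omega) using 1
      simp only [Fin.zero_eta]; ring
    · convert monomial_mem_lowDeg (a := a) (b := b + 1) (n := n + 1) (by omega) using 1
      simp only [Fin.mk_one]; ring
  | zero => simp
  | add f g _ _ hf hg => rw [mul_add]; exact add_mem hf hg
  | smul t f _ hf => rw [mul_smul_comm]; exact Submodule.smul_mem _ _ hf

/-- The substitution `x_i ↦ s_i x_i`. -/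
def rescale (s : Fin 2 → ℝ) : MvPolynomial (Fin 2) ℝ →ₐ[ℝ] MvPolynomial (Fin 2) ℝ :=
  aeval fun i => C (s i) * X i

lemma rescale_X (s : Fin 2 → ℝ) (i : Fin 2) : rescale s (X i) = C (s i) * X i := by
  simp [rescale]

lemma rescale_monomial (s : Fin 2 → ℝ) (a b : ℕ) :
    rescale s (X 0 ^ a * X 1 ^ b) = (s 0 ^ a * s 1 ^ b) • (X 0 ^ a * X 1 ^ b) := by
  rw [map_mul, map_pow, map_pow, rescale_X, rescale_X, smul_eq_C_mul]
  simp only [map_mul, map_pow]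
  ring

lemma rescale_mem_lowDeg {n : ℕ} (s : Fin 2 → ℝ) {f : MvPolynomial (Fin 2) ℝ}
    (h : f ∈ lowDeg n) : rescale s f ∈ lowDeg n := by
  induction h using Submodule.span_induction with
  | mem f hf =>
    obtain ⟨a, b, hab, rfl⟩ := hf
    rw [rescale_monomial]
    exact Submodule.smul_mem _ _ (monomial_mem_lowDeg hab)
  | zero => simp
  | add f g _ _ hf hg => rw [map_add]; exact add_mem hf hg
  | smul t f _ hf => rw [map_smul]; exact Submodule.smul_mem _ _ hf

lemma eval_rescale (s x : Fin 2 → ℝ) (f : MvPolynomial (Fin 2) ℝ) :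
    eval x (rescale s f) = eval (fun i => s i * x i) f := by
  induction f using MvPolynomial.induction_on with
  | C a => simp [rescale]
  | add f g hf hg => simp [hf, hg]
  | mul_X f i hf => simp [hf, rescale_X]

lemma MonicLead.sub_mem {n j : ℕ} {f : MvPolynomial (Fin 2) ℝ} (h : MonicLead n j f) :
    f - X 0 ^ (n - j) * X 1 ^ j ∈ lowDeg n := by
  rcases h with h | h
  · simp [h]
  · exact mem_lowDeg_of_totalDegree_lt h

lemma MonicLead.mem {n j : ℕ} {f : MvPolynomial (Fin 2) ℝ} (h : MonicLead n j f) (hj : j ≤ n) :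
    f ∈ lowDeg (n + 1) := by
  have h1 := add_mem (lowDeg_mono n.le_succ h.sub_mem)
    (monomial_mem_lowDeg (a := n - j) (b := j) (n := n + 1) (by omega))
  simpa using h1

section Orthogonal

variable {I : MvPolynomial (Fin 2) ℝ →ₗ[ℝ] ℝ}
  {S : (n : ℕ) → Fin (n + 1) → MvPolynomial (Fin 2) ℝ}
  {Smat : (n : ℕ) → Matrix (Fin (n + 1)) (Fin (n + 1)) ℝ}

lemma lowDeg_le_span (hm : ∀ (n : ℕ) (j : Fin (n + 1)), MonicLead n (j : ℕ) (S n j)) (n : ℕ) :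
    lowDeg n ≤ Submodule.span ℝ {f | ∃ (m : ℕ) (j : Fin (m + 1)), m < n ∧ f = S m j} := by
  induction n with
  | zero =>
    apply Submodule.span_le.2
    rintro f ⟨a, b, hab, rfl⟩
    omega
  | succ n ih =>
    have ih' : lowDeg n ≤
        Submodule.span ℝ {f | ∃ (m : ℕ) (j : Fin (m + 1)), m < n + 1 ∧ f = S m j} :=
      ih.trans (Submodule.span_mono fun f ⟨m, j, h, e⟩ => ⟨m, j, by omega, e⟩)
    apply Submodule.span_le.2
    rintro f ⟨a, b, hab, rfl⟩
    rcases (Nat.lt_succ_iff.1 hab).lt_or_eq with h | rfl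
    · exact ih' (monomial_mem_lowDeg h)
    · have h1 := ih' (hm (a + b) ⟨b, by omega⟩).sub_mem
      have h2 : S (a + b) ⟨b, by omega⟩ ∈ Submodule.span ℝ
          {f | ∃ (m : ℕ) (j : Fin (m + 1)), m < a + b + 1 ∧ f = S m j} :=
        Submodule.subset_span ⟨_, _, by omega, rfl⟩
      have h3 := sub_mem h2 h1
      simpa using h3

lemma apply_mul_eq_zero (hm : ∀ (n : ℕ) (j : Fin (n + 1)), MonicLead n (j : ℕ) (S n j))
    {n : ℕ} {f p : MvPolynomial (Fin 2) ℝ}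
    (hf : ∀ m < n, ∀ j : Fin (m + 1), I (f * S m j) = 0) (hp : p ∈ lowDeg n) :
    I (f * p) = 0 := by
  replace hp := lowDeg_le_span hm n hp
  induction hp using Submodule.span_induction with
  | mem p hp =>
    obtain ⟨m, j, hmn, rfl⟩ := hp
    exact hf m hmn j
  | zero => simp
  | add p q _ _ hp hq => rw [mul_add, map_add, hp, hq, add_zero]
  | smul t p _ hp => rw [mul_smul_comm, map_smul, hp, smul_zero]

lemma apply_mul_eq_zero_of_forall
    (hm : ∀ (n : ℕ) (j : Fin (n + 1)), MonicLead n (j : ℕ) (S n j))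
    {f : MvPolynomial (Fin 2) ℝ} (hf : ∀ m, ∀ j : Fin (m + 1), I (f * S m j) = 0)
    (p : MvPolynomial (Fin 2) ℝ) : I (f * p) = 0 :=
  apply_mul_eq_zero hm (fun m _ => hf m)
    (mem_lowDeg_of_totalDegree_lt (Nat.lt_succ_self p.totalDegree))

lemma apply_S_mul_eq_zero
    (hm : ∀ (n : ℕ) (j : Fin (n + 1)), MonicLead n (j : ℕ) (S n j))
    (ho : ∀ m n : ℕ, m ≠ n → ∀ (i : Fin (m + 1)) (j : Fin (n + 1)), I (S m i * S n j) = 0)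
    {m n : ℕ} (hmn : m ≤ n) (i : Fin (n + 1)) {p : MvPolynomial (Fin 2) ℝ}
    (hp : p ∈ lowDeg m) : I (S n i * p) = 0 :=
  apply_mul_eq_zero hm (fun k hk j => ho n k (by omega) i j) hp

lemma X_mul_S_sub_mem
    (hm : ∀ (n : ℕ) (j : Fin (n + 1)), MonicLead n (j : ℕ) (S n j)) (n : ℕ) (c : Fin 2)
    (i : Fin (n + 1)) :
    X c * S n i - S (n + 1) ⟨i + c, by omega⟩ ∈ lowDeg (n + 1) := by
  have h1 := X_mul_mem_lowDeg c (hm n i).sub_mem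
  have h2 := (hm (n + 1) ⟨i + c, by omega⟩).sub_mem
  convert sub_mem h1 h2 using 1
  have h3 : (X c * (X 0 ^ (n - (i : ℕ)) * X 1 ^ (i : ℕ)) : MvPolynomial (Fin 2) ℝ) =
      X 0 ^ (n + 1 - (i + c : ℕ)) * X 1 ^ (i + c : ℕ) := by
    fin_cases c
    · simp only [Fin.zero_eta, add_zero]
      rw [Nat.sub_add_comm (by omega)]
      ring
    · simp only [Fin.mk_one]
      rw [Nat.add_sub_add_right]
      ring
  simp only
  rw [← h3]
  ring

lemma rescale_neg_one_S_sub_mem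
    (hm : ∀ (n : ℕ) (j : Fin (n + 1)), MonicLead n (j : ℕ) (S n j)) (n : ℕ) (i : Fin (n + 1)) :
    rescale (fun _ => -1) (S n i) - (-1 : ℝ) ^ n • S n i ∈ lowDeg n := by
  have h1 := (hm n i).sub_mem
  convert sub_mem (rescale_mem_lowDeg (fun _ => -1) h1)
    (Submodule.smul_mem _ ((-1 : ℝ) ^ n) h1) using 1
  rw [map_sub, rescale_monomial, ← pow_add, Nat.sub_add_cancel (by omega), smul_sub]
  ring

lemma rescale_neg_one_involutive (f : MvPolynomial (Fin 2) ℝ) :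
    rescale (fun _ => -1) (rescale (fun _ => -1) f) = f := by
  refine MvPolynomial.funext fun x => ?_
  simp [eval_rescale]

lemma apply_rescale_neg_one_S_mul
    (hm : ∀ (n : ℕ) (j : Fin (n + 1)), MonicLead n (j : ℕ) (S n j))
    (ho : ∀ m n : ℕ, m ≠ n → ∀ (i : Fin (m + 1)) (j : Fin (n + 1)), I (S m i * S n j) = 0)
    (hc : ∀ f, I (rescale (fun _ => -1) f) = I f) (n : ℕ) (i : Fin (n + 1))
    (p : MvPolynomial (Fin 2) ℝ) :
    I (rescale (fun _ => -1) (S n i) * p) = (-1) ^ n * I (S n i * p) := by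
  have h : I ((rescale (fun _ => -1) (S n i) - (-1 : ℝ) ^ n • S n i) * p) = 0 := by
    refine apply_mul_eq_zero_of_forall hm (fun m j => ?_) p
    rcases lt_or_ge m n with h | h
    · rw [sub_mul, map_sub, smul_mul_assoc, map_smul, ho n m (by omega), smul_zero, sub_zero,
        ← rescale_neg_one_involutive (S m j), ← map_mul, hc]
      exact apply_S_mul_eq_zero hm ho h i (rescale_mem_lowDeg _ ((hm m j).mem (by omega)))
    · rw [mul_comm]
      exact apply_S_mul_eq_zero hm ho h j (rescale_neg_one_S_sub_mem hm n i)
  rw [sub_mul, map_sub, smul_mul_assoc, map_smul, smul_eq_mul] at h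
  linarith

lemma apply_X_mul_S_mul_S
    (hm : ∀ (n : ℕ) (j : Fin (n + 1)), MonicLead n (j : ℕ) (S n j))
    (ho : ∀ m n : ℕ, m ≠ n → ∀ (i : Fin (m + 1)) (j : Fin (n + 1)), I (S m i * S n j) = 0)
    (hc : ∀ f, I (rescale (fun _ => -1) f) = I f) (n : ℕ) (c : Fin 2) (i j : Fin (n + 1)) :
    I (X c * S n i * S n j) = 0 := by
  have h1 : I (X c * S n i * S n j) =
      -I (rescale (fun _ => -1) (S n i) * (X c * rescale (fun _ => -1) (S n j))) := by
    rw [← hc, map_mul (rescale _), map_mul (rescale _), rescale_X, ← map_neg]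
    congr 1
    simp only [map_neg, map_one]
    ring
  have h2 := apply_rescale_neg_one_S_mul hm ho hc n j (X c * S n i)
  rw [apply_rescale_neg_one_S_mul hm ho hc,
    show S n i * (X c * rescale (fun _ => -1) (S n j)) =
      rescale (fun _ => -1) (S n j) * (X c * S n i) by ring, h2, ← mul_assoc,
    ← pow_add, Even.neg_one_pow ⟨n, rfl⟩, one_mul, mul_comm (S n j)] at h1
  linarith

open Matrix

lemma Lmat_mul_apply {n : ℕ} {κ : Type*} (c : Fin 2) (A : Matrix (Fin (n + 2)) κ ℝ)
    (i : Fin (n + 1)) (j : κ) :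
    (Lmat n (c + 1) * A) i j = A ⟨i + c, by omega⟩ j := by
  rw [Matrix.mul_apply, Finset.sum_eq_single ⟨i + c, by omega⟩]
  · simp [Lmat]
  · intro b _ hb
    rw [Lmat, Matrix.of_apply, if_neg, zero_mul]
    simpa [Fin.ext_iff] using hb
  · simp

lemma Jmat_mul_apply {r s : ℕ} {κ : Type*} (h : 2 * r ≤ s) (A : Matrix (Fin s) κ ℝ)
    (i : Fin r) (j : κ) :
    (Jmat r s 1 * A) i j = A ⟨2 * i + 1, by omega⟩ j := by
  rw [Matrix.mul_apply, Finset.sum_eq_single ⟨2 * i + 1, by omega⟩]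
  · simp [Jmat]
  · intro b _ hb
    rw [Jmat, Matrix.of_apply, if_neg, zero_mul]
    simpa [Fin.ext_iff] using hb
  · simp

lemma mul_Jmat_transpose_apply {r s : ℕ} {κ : Type*} (h : 2 * r ≤ s) (A : Matrix κ (Fin s) ℝ)
    (i : κ) (j : Fin r) :
    (A * (Jmat r s 1)ᵀ) i j = A i ⟨2 * j + 1, by omega⟩ := by
  rw [← Matrix.transpose_apply (A * _), Matrix.transpose_mul, Matrix.transpose_transpose,
    Jmat_mul_apply h, Matrix.transpose_apply]

/-- The Gram matrix of `x_c S_n`, for a centrally symmetric functional. -/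
lemma gram_X_mul_S
    (hm : ∀ (n : ℕ) (j : Fin (n + 1)), MonicLead n (j : ℕ) (S n j))
    (ho : ∀ m n : ℕ, m ≠ n → ∀ (i : Fin (m + 1)) (j : Fin (n + 1)), I (S m i * S n j) = 0)
    (hSmat : ∀ (n : ℕ) (i j : Fin (n + 1)), Smat n i j = I (S n i * S n j))
    (hSdet : ∀ n : ℕ, IsUnit (Smat n).det)
    (hc : ∀ f, I (rescale (fun _ => -1) f) = I f) (n : ℕ) (c : Fin 2) :
    (Matrix.of fun i j : Fin (n + 2) => I (X c * S (n + 1) i * (X c * S (n + 1) j))) =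
      (Lmat (n + 1) (c + 1) * (Smat (n + 2) * (Lmat (n + 1) (c + 1))ᵀ * (Smat (n + 1))⁻¹) +
        Smat (n + 1) * (Lmat n (c + 1))ᵀ * (Smat n)⁻¹ * Lmat n (c + 1)) * Smat (n + 1) := by
  have hsymm : ∀ m, (Smat m)ᵀ = Smat m := fun m => by
    ext i j; rw [transpose_apply, hSmat, hSmat, mul_comm]
  set G := Smat (n + 1) * (Lmat n (c + 1))ᵀ * (Smat n)⁻¹ with hG
  have hcross : ∀ m (i : Fin (m + 1)) (j : Fin (m + 2)),
      I (X c * S m i * S (m + 1) j) = (Lmat m (c + 1) * Smat (m + 1)) i j := fun m i j => by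
    rw [Lmat_mul_apply, hSmat, ← sub_eq_zero, ← map_sub, ← sub_mul, mul_comm]
    exact apply_S_mul_eq_zero hm ho le_rfl j (X_mul_S_sub_mem hm m c i)
  have hGS : G * Smat n = (Lmat n (c + 1) * Smat (n + 1))ᵀ := by
    rw [hG, Matrix.mul_assoc _ _ (Smat n), Matrix.nonsing_inv_mul _ (hSdet n), Matrix.mul_one,
      transpose_mul, hsymm]
  have hR : ∀ (i : Fin (n + 2)) (p : MvPolynomial (Fin 2) ℝ),
      I ((X c * S (n + 1) i - S (n + 2) ⟨i + c, by omega⟩ - ∑ l, G i l • S n l) * p) = 0 := by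
    intro i
    have hmem : X c * S (n + 1) i - S (n + 2) ⟨i + c, by omega⟩ - ∑ l, G i l • S n l
        ∈ lowDeg (n + 2) := by
      refine sub_mem (X_mul_S_sub_mem hm (n + 1) c i) (Submodule.sum_mem _ fun l _ =>
        Submodule.smul_mem _ _ (lowDeg_mono (by omega) ((hm n l).mem (by omega))))
    refine apply_mul_eq_zero_of_forall hm fun m j => ?_
    rcases le_or_gt (n + 2) m with h | h
    · rw [mul_comm]
      exact apply_S_mul_eq_zero hm ho h j hmem
    · rw [sub_mul, sub_mul, map_sub, map_sub, ho (n + 2) m (by omega), Finset.sum_mul, map_sum]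
      simp only [smul_mul_assoc, map_smul, smul_eq_mul]
      rcases (Nat.lt_succ_iff.1 h).eq_or_lt with rfl | h
      · simp [ho n (n + 1), apply_X_mul_S_mul_S hm ho hc]
      rcases (Nat.lt_succ_iff.1 h).eq_or_lt with rfl | h
      · simp only [← hSmat]
        rw [← Matrix.mul_apply, hGS, transpose_apply, ← hcross,
          show X c * S (m + 1) i * S m j = X c * S m j * S (m + 1) i by ring]
        ring
      · have h1 : I (S (n + 1) i * (X c * S m j)) = 0 :=
          apply_S_mul_eq_zero hm ho (m := m + 2) (by omega) i
            (X_mul_mem_lowDeg c ((hm m j).mem (by omega)))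
        rw [show X c * S (n + 1) i * S m j = S (n + 1) i * (X c * S m j) by ring, h1]
        simp [ho n m (by omega)]
  have h1 : Lmat (n + 1) (c + 1) * (Smat (n + 2) * (Lmat (n + 1) (c + 1))ᵀ * (Smat (n + 1))⁻¹) *
      Smat (n + 1) = Lmat (n + 1) (c + 1) * (Lmat (n + 1) (c + 1) * Smat (n + 2))ᵀ := by
    rw [Matrix.mul_assoc, Matrix.mul_assoc _ _ (Smat (n + 1)),
      Matrix.nonsing_inv_mul _ (hSdet (n + 1)), Matrix.mul_one, transpose_mul, hsymm]
  rw [Matrix.add_mul, h1, Matrix.mul_assoc G]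
  ext i j
  have h := hR i (X c * S (n + 1) j)
  rw [sub_mul, sub_mul, map_sub, map_sub, Finset.sum_mul, map_sum, sub_sub, sub_eq_zero] at h
  rw [Matrix.of_apply, h, Matrix.add_apply, Lmat_mul_apply, transpose_apply, ← hcross,
    mul_comm (S (n + 2) _), Matrix.mul_apply]
  congr 1
  refine Finset.sum_congr rfl fun l _ => ?_
  rw [smul_mul_assoc, map_smul, smul_eq_mul, ← hcross]
  congr 2
  ring

/-- Odd-indexed rows of an even-degree Gram matrix are supported on odd-indexed columns. -/
lemma Jmat_mul_gram
    (hm : ∀ (n : ℕ) (j : Fin (n + 1)), MonicLead n (j : ℕ) (S n j))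
    (ho : ∀ m n : ℕ, m ≠ n → ∀ (i : Fin (m + 1)) (j : Fin (n + 1)), I (S m i * S n j) = 0)
    (hSmat : ∀ (n : ℕ) (i j : Fin (n + 1)), Smat n i j = I (S n i * S n j))
    (hy : ∀ f, I (rescale ![1, -1] f) = I f) (n : ℕ)
    (hodd : ∀ j : Fin (n + 1), rescale ![1, -1] (S (2 * n + 2) ⟨2 * j + 1, by omega⟩) =
      -S (2 * n + 2) ⟨2 * j + 1, by omega⟩)
    {Q : Matrix (Fin (n + 1)) (Fin (n + 1)) ℝ}
    (hQ : ∀ i j : Fin (n + 1), Q i j = 1 / 4 * I (S (2 * n + 2) ⟨2 * i + 1, by omega⟩ *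
      S (2 * n + 2) ⟨2 * j + 1, by omega⟩)) :
    Jmat (n + 1) (2 * n + 3) 1 * Smat (2 * n + 2) = (4 : ℝ) • (Q * Jmat (n + 1) (2 * n + 3) 1) := by
  ext i j
  rw [Jmat_mul_apply (by omega), hSmat, Matrix.smul_apply, Matrix.mul_apply, smul_eq_mul]
  rcases Nat.even_or_odd' (j : ℕ) with ⟨b, hb | hb⟩
  · rw [Finset.sum_eq_zero fun l _ => by
      rw [Jmat, Matrix.of_apply, if_neg (by omega), mul_zero], mul_zero]
    have h1 := apply_S_mul_eq_zero hm ho le_rfl ⟨2 * (i : ℕ) + 1, by omega⟩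
      (hm (2 * n + 2) j).sub_mem
    rw [mul_sub, map_sub, sub_eq_zero] at h1
    rw [h1]
    have h2 := hy (S (2 * n + 2) ⟨2 * (i : ℕ) + 1, by omega⟩ *
      (X 0 ^ (2 * n + 2 - (j : ℕ)) * X 1 ^ (j : ℕ)))
    rw [map_mul, hodd, rescale_monomial] at h2
    simp [hb] at h2
    rw [hb]
    linarith
  · rw [Finset.sum_eq_single ⟨b, by omega⟩]
    · rw [hQ]
      simp [Jmat, hb]
      congr 4
      exact Fin.ext hb
    · intro l _ hl
      rw [Jmat, Matrix.of_apply, if_neg, mul_zero]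
      intro h
      exact hl (Fin.ext (by simp; omega))
    · simp

lemma Jmat_mul_inv {r s : ℕ} {A : Matrix (Fin s) (Fin s) ℝ} {Q : Matrix (Fin r) (Fin r) ℝ}
    {J : Matrix (Fin r) (Fin s) ℝ} {t : ℝ} (ht : t ≠ 0) (hA : IsUnit A.det) (hQ : IsUnit Q.det)
    (h : J * A = t • (Q * J)) : J * A⁻¹ = t⁻¹ • (Q⁻¹ * J) := by
  have h1 : J = t • (Q * (J * A⁻¹)) := by
    rw [← Matrix.mul_assoc, ← Matrix.smul_mul, ← h, Matrix.mul_assoc, Matrix.mul_nonsing_inv _ hA,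
      Matrix.mul_one]
  conv_rhs => rw [h1]
  rw [Matrix.mul_smul, smul_smul, inv_mul_cancel₀ ht, one_smul, ← Matrix.mul_assoc,
    Matrix.nonsing_inv_mul _ hQ, Matrix.one_mul]

lemma Jmat_mul_Lmat_transpose (n : ℕ) (c : Fin 2) :
    Jmat (n + 2) (2 * n + 5) 1 * (Lmat (2 * n + 3) (c + 1))ᵀ * (Lmat (2 * n + 2) (c + 1))ᵀ *
      (Jmat (n + 1) (2 * n + 3) 1)ᵀ = (Lmat n (c + 1))ᵀ := by
  rw [Matrix.mul_assoc, Matrix.mul_assoc]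
  ext i j
  rw [Jmat_mul_apply (by omega), ← Matrix.mul_assoc, mul_Jmat_transpose_apply (by omega),
    ← Matrix.transpose_mul, Matrix.transpose_apply, Matrix.transpose_apply, Lmat_mul_apply]
  simp only [Lmat, Matrix.of_apply]
  congr 1
  simp
  omega

end Orthogonal

section Integral

lemma ev_mul (p : ℝ × ℝ) (f g : MvPolynomial (Fin 2) ℝ) : ev p (f * g) = ev p f * ev p g :=
  map_mul (eval ![p.1, p.2]) f g

lemma IsWeight.integrableOn {Ω : Set (ℝ × ℝ)} {W : ℝ × ℝ → ℝ} (hW : IsWeight Ω W)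
    (f : MvPolynomial (Fin 2) ℝ) : IntegrableOn (fun p => ev p f * W p) Ω := by
  have h : (fun p : ℝ × ℝ => ev p f * W p) = fun p =>
      ∑ d ∈ f.support, coeff d f * (p.1 ^ d 0 * p.2 ^ d 1 * W p) := by
    funext p
    rw [ev, eval_eq', Finset.sum_mul]
    refine Finset.sum_congr rfl fun d _ => ?_
    simp [Fin.prod_univ_two]
    ring
  rw [h]
  exact integrable_finsetSum _ fun d _ => (hW.2.2.2.2 (d 0) (d 1)).const_mul _

/-- The moment functional `f ↦ ∫_Ω f W`. -/
def momentFunctional {Ω : Set (ℝ × ℝ)} {W : ℝ × ℝ → ℝ} (hW : IsWeight Ω W) :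
    MvPolynomial (Fin 2) ℝ →ₗ[ℝ] ℝ where
  toFun f := ∫ p in Ω, ev p f * W p
  map_add' f g := by
    rw [← integral_add (hW.integrableOn f) (hW.integrableOn g)]
    simp [ev, add_mul]
  map_smul' t f := by
    simp [ev, ← integral_const_mul, smul_eval, mul_assoc]

/-- The reflection `(x, y) ↦ (-x, y)`. -/
def reflectX : ℝ × ℝ ≃ᵐ ℝ × ℝ := (MeasurableEquiv.neg ℝ).prodCongr (.refl ℝ)

/-- The reflection `(x, y) ↦ (x, -y)`. -/
def reflectY : ℝ × ℝ ≃ᵐ ℝ × ℝ := (MeasurableEquiv.refl ℝ).prodCongr (.neg ℝ)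

lemma measurePreserving_reflectX : MeasurePreserving reflectX :=
  (Measure.measurePreserving_neg (volume : Measure ℝ)).prod (.id volume)

lemma measurePreserving_reflectY : MeasurePreserving reflectY :=
  (MeasurePreserving.id volume).prod (Measure.measurePreserving_neg (volume : Measure ℝ))

lemma reflectX_apply (p : ℝ × ℝ) : reflectX p = (-p.1, p.2) := rfl

lemma reflectY_apply (p : ℝ × ℝ) : reflectY p = (p.1, -p.2) := rfl

lemma setIntegral_comp_involution {T : ℝ × ℝ ≃ᵐ ℝ × ℝ} (hT : MeasurePreserving T)
    (hTT : ∀ p, T (T p) = p) {Ω : Set (ℝ × ℝ)} (hΩ : ∀ p ∈ Ω, T p ∈ Ω) (h : ℝ × ℝ → ℝ) :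
    ∫ p in Ω, h (T p) = ∫ p in Ω, h p := by
  have h1 : T ⁻¹' Ω = Ω := by
    ext p
    exact ⟨fun hp => hTT p ▸ hΩ _ hp, hΩ p⟩
  conv_lhs => rw [← h1]
  exact hT.setIntegral_preimage_emb T.measurableEmbedding h Ω

/-- Folding of an invariant integral along an involution exchanging two halves of the domain. -/
lemma setIntegral_eq_two_mul {T : ℝ × ℝ ≃ᵐ ℝ × ℝ} (hT : MeasurePreserving T)
    (hTT : ∀ p, T (T p) = p) {Ω A : Set (ℝ × ℝ)} (hΩm : MeasurableSet Ω) (hA : MeasurableSet A)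
    (hΩ : ∀ p ∈ Ω, T p ∈ Ω) {h : ℝ × ℝ → ℝ} (hint : IntegrableOn h Ω)
    (hh : ∀ p ∈ Ω, h (T p) = h p) (hdisj : ∀ p ∈ A, T p ∉ A)
    (hzero : ∀ p ∉ A, T p ∉ A → h p = 0) :
    ∫ p in Ω, h p = 2 * ∫ p in Ω ∩ A, h p := by
  have h1 : ∫ p in Ω \ A, h p = ∫ p in T ⁻¹' (Ω ∩ A), h p := by
    refine setIntegral_eq_of_subset_of_forall_sdiff_eq_zero (hΩm.diff hA) ?_ ?_
    · rintro p ⟨hp1, hp2⟩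
      exact ⟨hTT p ▸ hΩ _ hp1, fun hp => hdisj p hp hp2⟩
    · rintro p ⟨⟨hp1, hp2⟩, hp3⟩
      exact hzero p hp2 fun hp => hp3 ⟨hΩ p hp1, hp⟩
  have h2 : ∫ p in T ⁻¹' (Ω ∩ A), h p = ∫ p in T ⁻¹' (Ω ∩ A), h (T p) := by
    refine setIntegral_congr_fun (T.measurable (hΩm.inter hA)) fun p hp => ?_
    exact (hh p (hTT p ▸ hΩ _ hp.1)).symm
  rw [← integral_inter_add_sdiff hA hint, h1, h2,
    hT.setIntegral_preimage_emb T.measurableEmbedding, two_mul]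

/-- The derivative of `(x, y) ↦ (x², y²)`. -/
def sqDeriv (p : ℝ × ℝ) : ℝ × ℝ →L[ℝ] ℝ × ℝ :=
  ((2 * p.1) • ContinuousLinearMap.id ℝ ℝ).prodMap ((2 * p.2) • ContinuousLinearMap.id ℝ ℝ)

lemma hasFDerivAt_sq_prod (p : ℝ × ℝ) :
    HasFDerivAt (fun p : ℝ × ℝ => (p.1 ^ 2, p.2 ^ 2)) (sqDeriv p) p := by
  have h : ∀ x : ℝ, HasFDerivAt (fun x : ℝ => x ^ 2) ((2 * x) • ContinuousLinearMap.id ℝ ℝ) x := by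
    intro x
    rw [hasFDerivAt_iff_hasDerivAt]
    simpa using hasDerivAt_pow 2 x
  exact (h p.1).prodMap p (h p.2)

lemma det_sqDeriv (p : ℝ × ℝ) : (sqDeriv p).det = 4 * (p.1 * p.2) := by
  have h : ((sqDeriv p : ℝ × ℝ →L[ℝ] ℝ × ℝ) : ℝ × ℝ →ₗ[ℝ] ℝ × ℝ) =
      ((2 * p.1) • LinearMap.id).prodMap ((2 * p.2) • LinearMap.id) := rfl
  rw [ContinuousLinearMap.det, h, LinearMap.det_prodMap]
  simp
  ring

lemma setIntegral_Ωstar {Ω : Set (ℝ × ℝ)} {W : ℝ × ℝ → ℝ} (hΩm : MeasurableSet Ω)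
    (hsym : XYSymmetric Ω W) (g : ℝ × ℝ → ℝ)
    (hint : IntegrableOn
      (fun p : ℝ × ℝ => g (p.1 ^ 2, p.2 ^ 2) * (p.1 ^ 2 * p.2 ^ 2) * W p) Ω) :
    ∫ z in Ωstar Ω, g z * (z.1 * z.2 * W00 W z) =
      1 / 4 * ∫ p in Ω, g (p.1 ^ 2, p.2 ^ 2) * (p.1 ^ 2 * p.2 ^ 2) * W p := by
  have hA : MeasurableSet {p : ℝ × ℝ | 0 < p.1} := measurableSet_lt measurable_const measurable_fst
  have hB : MeasurableSet {p : ℝ × ℝ | 0 < p.2} := measurableSet_lt measurable_const measurable_snd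
  have hΩs : MeasurableSet (Ωstar Ω) := by
    refine (measurableSet_le measurable_const measurable_fst).inter
      ((measurableSet_le measurable_const measurable_snd).inter (?_ : MeasurableSet
        ((fun q : ℝ × ℝ => (Real.sqrt q.1, Real.sqrt q.2)) ⁻¹' Ω)))
    exact (by fun_prop : Measurable fun q : ℝ × ℝ => (Real.sqrt q.1, Real.sqrt q.2)) hΩm
  set s := Ω ∩ {p : ℝ × ℝ | 0 < p.1} ∩ {p : ℝ × ℝ | 0 < p.2} with hs
  have hsm : MeasurableSet s := (hΩm.inter hA).inter hB
  have h1 := setIntegral_eq_two_mul measurePreserving_reflectX (fun p => by simp [reflectX_apply])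
    hΩm hA (fun p hp => (hsym.1 p hp).1) hint
    (fun p hp => by simp [reflectX_apply, (hsym.2 p hp).1])
    (fun p hp => by simp only [Set.mem_ofPred_eq, reflectX_apply] at *; linarith)
    (fun p hp hp' => by
      have : p.1 = 0 := by simp only [Set.mem_ofPred_eq, reflectX_apply] at *; linarith
      simp [this])
  have h2 := setIntegral_eq_two_mul measurePreserving_reflectY (fun p => by simp [reflectY_apply])
    (hΩm.inter hA) hB (fun p hp => ⟨(hsym.1 p hp.1).2, hp.2⟩) (hint.mono_set Set.inter_subset_left)
    (fun p hp => by simp [reflectY_apply, (hsym.2 p hp.1).2])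
    (fun p hp => by simp only [Set.mem_ofPred_eq, reflectY_apply] at *; linarith)
    (fun p hp hp' => by
      have : p.2 = 0 := by simp only [Set.mem_ofPred_eq, reflectY_apply] at *; linarith
      simp [this])
  rw [h1, h2, ← hs]
  have himg : (fun p : ℝ × ℝ => (p.1 ^ 2, p.2 ^ 2)) '' s ⊆ Ωstar Ω := by
    rintro _ ⟨p, ⟨⟨hp, hp1⟩, hp2⟩, rfl⟩
    refine ⟨sq_nonneg _, sq_nonneg _, ?_⟩
    simp only [Set.mem_ofPred_eq] at hp1 hp2
    simpa [Real.sqrt_sq hp1.le, Real.sqrt_sq hp2.le] using hp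
  have hinj : Set.InjOn (fun p : ℝ × ℝ => (p.1 ^ 2, p.2 ^ 2)) s := by
    rintro p ⟨⟨_, hp1⟩, hp2⟩ r ⟨⟨_, hr1⟩, hr2⟩ h
    simp only [Set.mem_ofPred_eq, Prod.mk.injEq] at hp1 hp2 hr1 hr2 h
    exact Prod.ext ((pow_left_inj₀ hp1.le hr1.le two_ne_zero).1 h.1)
      ((pow_left_inj₀ hp2.le hr2.le two_ne_zero).1 h.2)
  rw [setIntegral_eq_of_subset_of_forall_sdiff_eq_zero hΩs himg,
    integral_image_eq_integral_abs_det_fderiv_smul volume hsm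
      (fun p _ => (hasFDerivAt_sq_prod p).hasFDerivWithinAt) hinj, ← mul_assoc, ← mul_assoc]
  · norm_num
    refine setIntegral_congr_fun hsm ?_
    rintro p ⟨⟨_, hp1⟩, hp2⟩
    simp only [Set.mem_ofPred_eq] at hp1 hp2
    have hp := mul_pos hp1 hp2
    simp only [det_sqDeriv, W00, Real.sqrt_sq hp1.le, Real.sqrt_sq hp2.le, ← mul_pow,
      Real.sqrt_sq hp.le, abs_of_pos (mul_pos four_pos hp)]
    field_simp
  · rintro z ⟨⟨hz1, hz2, hz⟩, hz'⟩
    rcases hz1.eq_or_lt with h | h1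
    · simp [← h]
    rcases hz2.eq_or_lt with h | h2
    · simp [← h]
    exact absurd ⟨_, ⟨⟨hz, Real.sqrt_pos.2 h1⟩, Real.sqrt_pos.2 h2⟩,
      by simp [Real.sq_sqrt hz1, Real.sq_sqrt hz2]⟩ hz'

variable {Ω : Set (ℝ × ℝ)} {W : ℝ × ℝ → ℝ}

lemma momentFunctional_rescale_Y (hW : IsWeight Ω W) (hsym : XYSymmetric Ω W)
    (f : MvPolynomial (Fin 2) ℝ) :
    momentFunctional hW (rescale ![1, -1] f) = momentFunctional hW f := by
  refine Eq.trans ?_ (setIntegral_comp_involution measurePreserving_reflectY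
    (fun p => by simp [reflectY_apply]) (fun p hp => (hsym.1 p hp).2) _)
  refine setIntegral_congr_fun hW.1 fun p hp => ?_
  simp only [ev, eval_rescale, reflectY_apply, (hsym.2 p hp).2]
  congr 3
  funext i
  fin_cases i <;> simp

lemma momentFunctional_rescale_neg_one (hW : IsWeight Ω W) (hsym : XYSymmetric Ω W)
    (f : MvPolynomial (Fin 2) ℝ) :
    momentFunctional hW (rescale (fun _ => -1) f) = momentFunctional hW f := by
  rw [← momentFunctional_rescale_Y hW hsym f]
  refine Eq.trans ?_ (setIntegral_comp_involution measurePreserving_reflectX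
    (fun p => by simp [reflectX_apply]) (fun p hp => (hsym.1 p hp).1) _)
  refine setIntegral_congr_fun hW.1 fun p hp => ?_
  simp only [ev, eval_rescale, reflectX_apply, (hsym.2 p hp).1]
  congr 3
  funext i
  fin_cases i <;> simp

/-- Integration against `W^(1,1)` in terms of the moment functional of `W`. -/
lemma setIntegral_Ωstar_eq_momentFunctional (hW : IsWeight Ω W) (hsym : XYSymmetric Ω W)
    (g : ℝ × ℝ → ℝ) (f : MvPolynomial (Fin 2) ℝ)
    (hgf : ∀ p : ℝ × ℝ, ev p f = g (p.1 ^ 2, p.2 ^ 2) * (p.1 ^ 2 * p.2 ^ 2)) :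
    ∫ z in Ωstar Ω, g z * (z.1 * z.2 * W00 W z) = 1 / 4 * momentFunctional hW f := by
  have h := hW.integrableOn f
  simp only [hgf] at h
  rw [setIntegral_Ωstar hW.1 hsym g h]
  simp [momentFunctional, hgf]

end Integral

open Matrix in
/-- Bäcklund-type relations for the family `{P̂ₙ^(1,1)}` (case `(i,j) = (1,1)` of
Theorem `Backlund`): with `Γ_{n,k} = 𝐒ₙ L_{n-1,k}ᵀ 𝐒_{n-1}⁻¹` (here `Γp m k = Γ_{m+1,k}`),
`D̂_{n,k}^(1,1) = J_n⁽¹'¹⁾ [L_{2n+2,k} Γ_{2n+3,k} + Γ_{2n+2,k} L_{2n+1,k}] (J_n⁽¹'¹⁾)ᵀ`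
for all `n ≥ 0`, and
`Ĉ_{n,k}^(1,1) = J_n⁽¹'¹⁾ Γ_{2n+2,k} Γ_{2n+1,k} (J_{n-1}⁽¹'¹⁾)ᵀ` for `n = m + 1 ≥ 1`,
where `D̂_{n,k}^(1,1) = (∫ u_k Q̂ₙ Q̂ₙᵀ W⁽¹'¹⁾) 𝐐̂ₙ⁻¹` and
`Ĉ_{n,k}^(1,1) = 𝐐̂ₙ L_{n-1,k}ᵀ 𝐐̂_{n-1}⁻¹`. -/
theorem stmt16 (Ω : Set (ℝ × ℝ)) (W : ℝ × ℝ → ℝ) (hW : IsWeight Ω W)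
    (hsym : XYSymmetric Ω W)
    (S : (n : ℕ) → Fin (n + 1) → MvPolynomial (Fin 2) ℝ) (hS : IsMOPS Ω W S)
    (Smat : (n : ℕ) → Matrix (Fin (n + 1)) (Fin (n + 1)) ℝ)
    (hSmat : ∀ (n : ℕ) (i j : Fin (n + 1)),
      Smat n i j = ∫ q in Ω, ev q (S n i) * ev q (S n j) * W q)
    (hSdet : ∀ n : ℕ, IsUnit (Smat n).det)
    (Γp : (m : ℕ) → ℕ → Matrix (Fin (m + 2)) (Fin (m + 1)) ℝ)
    (hΓ : ∀ (m kk : ℕ), Γp m kk = Smat (m + 1) * (Lmat m kk)ᵀ * (Smat m)⁻¹)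
    (q : (n : ℕ) → Fin (n + 1) → MvPolynomial (Fin 2) ℝ)
    (hrel : ∀ (n : ℕ) (j : Fin (n + 1)) (x y : ℝ),
      eval ![x, y] (S (2 * n + 2) ⟨2 * (j : ℕ) + 1, by have := j.isLt; omega⟩) =
        x * y * eval ![x ^ 2, y ^ 2] (q n j))
    (Qmat : (n : ℕ) → Matrix (Fin (n + 1)) (Fin (n + 1)) ℝ)
    (hQmat : ∀ (n : ℕ) (i j : Fin (n + 1)),
      Qmat n i j = ∫ z in Ωstar Ω, ev z (q n i) * ev z (q n j) * (z.1 * z.2 * W00 W z))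
    (hQdet : ∀ n : ℕ, IsUnit (Qmat n).det)
    (k : ℕ) (hk : k = 1 ∨ k = 2) :
    (∀ n : ℕ,
      (Matrix.of fun i j : Fin (n + 1) =>
        ∫ z in Ωstar Ω, (if k = 1 then z.1 else z.2) *
          (ev z (q n i) * ev z (q n j) * (z.1 * z.2 * W00 W z))) * (Qmat n)⁻¹ =
      Jmat (n + 1) (2 * n + 3) 1 *
        (Lmat (2 * n + 2) k * Γp (2 * n + 2) k + Γp (2 * n + 1) k * Lmat (2 * n + 1) k) *
        (Jmat (n + 1) (2 * n + 3) 1)ᵀ) ∧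
    (∀ m : ℕ,
      Qmat (m + 1) * (Lmat m k)ᵀ * (Qmat m)⁻¹ =
      Jmat (m + 2) (2 * m + 5) 1 * (Γp (2 * m + 3) k * Γp (2 * m + 2) k) *
        (Jmat (m + 1) (2 * m + 3) 1)ᵀ) := by
  obtain ⟨hm, ho'⟩ := hS
  have hIdef : ∀ f g, momentFunctional hW (f * g) = ∫ p in Ω, ev p f * ev p g * W p := by
    intro f g
    simp [momentFunctional, ev]
  have hy := momentFunctional_rescale_Y hW hsym
  have hc := momentFunctional_rescale_neg_one hW hsym
  have htrans := setIntegral_Ωstar_eq_momentFunctional hW hsym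
  generalize momentFunctional hW = I at hIdef hy hc htrans
  have ho : ∀ m n : ℕ, m ≠ n → ∀ (i : Fin (m + 1)) (j : Fin (n + 1)), I (S m i * S n j) = 0 :=
    fun m n h i j => by rw [hIdef]; exact ho' m n h i j
  replace hSmat : ∀ (n : ℕ) (i j : Fin (n + 1)), Smat n i j = I (S n i * S n j) :=
    fun n i j => by rw [hIdef]; exact hSmat n i j
  have hev : ∀ (n : ℕ) (j : Fin (n + 1)) (p : ℝ × ℝ),
      ev p (S (2 * n + 2) ⟨2 * (j : ℕ) + 1, by omega⟩) =
        p.1 * p.2 * ev (p.1 ^ 2, p.2 ^ 2) (q n j) := fun n j p => hrel n j p.1 p.2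
  have hodd : ∀ (n : ℕ) (j : Fin (n + 1)),
      rescale ![1, -1] (S (2 * n + 2) ⟨2 * j + 1, by omega⟩) =
        -S (2 * n + 2) ⟨2 * j + 1, by omega⟩ := by
    intro n j
    refine MvPolynomial.funext fun x => ?_
    have h1 : (fun i => (![1, -1] : Fin 2 → ℝ) i * x i) = ![x 0, -x 1] := by
      funext i; fin_cases i <;> simp
    have h2 : x = ![x 0, x 1] := by funext i; fin_cases i <;> rfl
    rw [eval_rescale, h1, map_neg]
    conv_rhs => rw [h2]
    rw [hrel, hrel]
    simp
  have hQ : ∀ (n : ℕ) (i j : Fin (n + 1)), Qmat n i j = 1 / 4 *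
      I (S (2 * n + 2) ⟨2 * i + 1, by omega⟩ * S (2 * n + 2) ⟨2 * j + 1, by omega⟩) := by
    intro n i j
    rw [hQmat]
    refine htrans (fun z => ev z (q n i) * ev z (q n j)) _ fun p => ?_
    rw [ev_mul, hev, hev]
    ring
  have hJ : ∀ n, Jmat (n + 1) (2 * n + 3) 1 * Smat (2 * n + 2) =
      (4 : ℝ) • (Qmat n * Jmat (n + 1) (2 * n + 3) 1) := fun n =>
    Jmat_mul_gram hm ho hSmat hy n (hodd n) (hQ n)
  have hSsymm : ∀ m, (Smat m)ᵀ = Smat m := fun m => by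
    ext i j; rw [transpose_apply, hSmat, hSmat, mul_comm]
  have hQsymm : ∀ m, (Qmat m)ᵀ = Qmat m := fun m => by
    ext i j; rw [transpose_apply, hQ, hQ, mul_comm (S _ _)]
  have hJt : ∀ n, Smat (2 * n + 2) * (Jmat (n + 1) (2 * n + 3) 1)ᵀ =
      (4 : ℝ) • ((Jmat (n + 1) (2 * n + 3) 1)ᵀ * Qmat n) := fun n => by
    have h := congrArg transpose (hJ n)
    rwa [transpose_mul, transpose_smul, transpose_mul, hSsymm, hQsymm] at h
  obtain ⟨c, rfl⟩ : ∃ c : Fin 2, k = c + 1 := by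
    rcases hk with rfl | rfl
    exacts [⟨0, rfl⟩, ⟨1, rfl⟩]
  refine ⟨fun n => ?_, fun m => ?_⟩
  · have hD : (Matrix.of fun i j : Fin (n + 1) =>
        ∫ z in Ωstar Ω, (if (c : ℕ) + 1 = 1 then z.1 else z.2) *
          (ev z (q n i) * ev z (q n j) * (z.1 * z.2 * W00 W z))) =
        (1 / 4 : ℝ) • (Jmat (n + 1) (2 * n + 3) 1 *
          (Matrix.of fun i j : Fin (2 * n + 3) =>
            I (X c * S (2 * n + 2) i * (X c * S (2 * n + 2) j))) *
          (Jmat (n + 1) (2 * n + 3) 1)ᵀ) := by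
      ext i j
      rw [Matrix.smul_apply, mul_Jmat_transpose_apply (by omega), Jmat_mul_apply (by omega),
        Matrix.of_apply, Matrix.of_apply, smul_eq_mul]
      simp only [← mul_assoc (ite _ _ _ : ℝ)]
      refine htrans (fun z => (if (c : ℕ) + 1 = 1 then z.1 else z.2) *
        ev z (q n i) * ev z (q n j)) _ fun p => ?_
      rw [ev_mul, ev_mul, ev_mul, hev, hev]
      fin_cases c <;> simp [ev] <;> ring
    rw [hD, gram_X_mul_S hm ho hSmat hSdet hc (2 * n + 1) c, hΓ, hΓ, ← Matrix.mul_assoc (Jmat _ _ _),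
      Matrix.mul_assoc _ (Smat _) (Jmat _ _ _)ᵀ, hJt, Matrix.mul_smul, smul_smul,
      ← Matrix.mul_assoc _ _ (Qmat n)]
    norm_num
    rw [Matrix.mul_assoc _ (Qmat n), Matrix.mul_nonsing_inv _ (hQdet n), Matrix.mul_one]
  · have hinv := congrArg transpose
      (Jmat_mul_inv four_ne_zero (hSdet (2 * m + 2)) (hQdet m) (hJ m))
    rw [transpose_mul, transpose_smul, transpose_mul, transpose_nonsing_inv, hSsymm,
      transpose_nonsing_inv, hQsymm] at hinv
    have hG : Γp (2 * m + 3) (c + 1) * Γp (2 * m + 2) (c + 1) =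
        Smat (2 * m + 4) * ((Lmat (2 * m + 3) (c + 1))ᵀ * (Lmat (2 * m + 2) (c + 1))ᵀ) *
          (Smat (2 * m + 2))⁻¹ := by
      rw [hΓ, hΓ, ← Matrix.mul_assoc, ← Matrix.mul_assoc, Matrix.mul_assoc _ (Smat _)⁻¹ (Smat _),
        Matrix.nonsing_inv_mul _ (hSdet _), Matrix.mul_one, ← Matrix.mul_assoc]
    have hJ' : Jmat (m + 2) (2 * m + 5) 1 * Smat (2 * m + 4) =
      (4 : ℝ) • (Qmat (m + 1) * Jmat (m + 2) (2 * m + 5) 1) := hJ (m + 1)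
    have hassoc : Jmat (m + 2) (2 * m + 5) 1 * (Γp (2 * m + 3) (c + 1) * Γp (2 * m + 2) (c + 1)) *
        (Jmat (m + 1) (2 * m + 3) 1)ᵀ = Jmat (m + 2) (2 * m + 5) 1 * Smat (2 * m + 4) *
          ((Lmat (2 * m + 3) (c + 1))ᵀ * (Lmat (2 * m + 2) (c + 1))ᵀ) *
          ((Smat (2 * m + 2))⁻¹ * (Jmat (m + 1) (2 * m + 3) 1)ᵀ) := by
      rw [hG]
      simp only [Matrix.mul_assoc]
    rw [hassoc, hJ', hinv, ← Jmat_mul_Lmat_transpose]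
    simp only [Matrix.mul_smul, Matrix.smul_mul, smul_smul, Matrix.mul_assoc]
    norm_num
end
end

section
/- Let W be an xy-symmetric weight function on a measurable set Ω ⊆ ℝ² and {Sₙ} the MOPS of W, with invertible Gram matrices 𝐒ₙ = ∫_Ω Sₙ Sₙᵀ W dx dy, and set Γ_{n,k} = 𝐒ₙ L_{n−1,k}ᵀ 𝐒_{n−1}⁻¹ for n ≥ 1, k ∈ {1,2}. Suppose r_{n,k} and s_{n,k} are real bivariate polynomials with S_{2n+1,2k}(x,y) = x·r_{n,k}(x²,y²) and S_{2n+1,2k+1}(x,y) = y·s_{n,k}(x²,y²) (0 ≤ k ≤ n); set R̂ₙ = (r_{n,0},…,r_{n,n})ᵀ, Ŝₙ = (s_{n,0},…,s_{n,n})ᵀ, and assume the Gram matrices 𝐑̂ₙ = ∫_{Ω*} R̂ₙ R̂ₙᵀ W^{(1,0)} du dv and 𝐒̂ₙ = ∫_{Ω*} Ŝₙ Ŝₙᵀ W^{(0,1)} du dv are invertible. Then for all n ≥ 0 and k ∈ {1,2} (u₁ = u, u₂ = v): (∫_{Ω*} u_k·R̂ₙ R̂ₙᵀ W^{(1,0)}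 du dv)·𝐑̂ₙ⁻¹ = J_n^{(1,0)}[L_{2n+1,k}Γ_{2n+2,k} + Γ_{2n+1,k}L_{2n,k}](J_n^{(1,0)})ᵀ and (∫_{Ω*} u_k·Ŝₙ Ŝₙᵀ W^{(0,1)} du dv)·𝐒̂ₙ⁻¹ = J_n^{(0,1)}[L_{2n+1,k}Γ_{2n+2,k} + Γ_{2n+1,k}L_{2n,k}](J_n^{(0,1)})ᵀ; and for n ≥ 1: 𝐑̂ₙ L_{n−1,k}ᵀ 𝐑̂_{n−1}⁻¹ = J_n^{(1,0)} Γ_{2n+1,k} Γ_{2n,k} (J_{n−1}^{(1,0)})ᵀ and 𝐒̂ₙ L_{n−1,k}ᵀ 𝐒̂_{n−1}⁻¹ = J_n^{(0,1)} Γ_{2n+1,k} Γ_{2n,k} (J_{n−1}^{(0,1)})ᵀ. -/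
noncomputable section

open MeasureTheory MvPolynomial

lemma integrableOn_ev_mul {Ω : Set (ℝ × ℝ)} {W : ℝ × ℝ → ℝ} (hW : IsWeight Ω W)
    (f : MvPolynomial (Fin 2) ℝ) : IntegrableOn (fun q => ev q f * W q) Ω := by
  induction f using MvPolynomial.induction_on' with
  | monomial u a =>
    have h := (hW.2.2.2.2 (u 0) (u 1)).const_mul a
    refine h.congr (ae_of_all _ fun q => ?_)
    simp [ev, eval_monomial, Finsupp.prod_fintype]
    ring
  | add p q hp hq =>
    refine (hp.add hq).congr (ae_of_all _ fun z => ?_)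
    simp [ev, add_mul]

/-- Integration against the weight `W` on `Ω`, as a linear functional on polynomials. -/
def weightFunctional {Ω : Set (ℝ × ℝ)} {W : ℝ × ℝ → ℝ} (hW : IsWeight Ω W) :
    MvPolynomial (Fin 2) ℝ →ₗ[ℝ] ℝ where
  toFun f := ∫ q in Ω, ev q f * W q
  map_add' f g := by
    rw [← integral_add (integrableOn_ev_mul hW f) (integrableOn_ev_mul hW g)]
    simp [ev, add_mul]
  map_smul' c f := by
    simp [ev, smul_eval, mul_assoc, integral_const_mul]

lemma weightFunctional_apply {Ω : Set (ℝ × ℝ)} {W : ℝ × ℝ → ℝ} (hW : IsWeight Ω W)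
    (f : MvPolynomial (Fin 2) ℝ) : weightFunctional hW f = ∫ q in Ω, ev q f * W q := rfl

lemma weightFunctional_mul {Ω : Set (ℝ × ℝ)} {W : ℝ × ℝ → ℝ} (hW : IsWeight Ω W)
    (f g : MvPolynomial (Fin 2) ℝ) :
    weightFunctional hW (f * g) = ∫ q in Ω, ev q f * ev q g * W q := by
  simp [weightFunctional_apply, ev]

lemma measurePreserving_neg_fst :
    MeasurePreserving (fun p : ℝ × ℝ => (-p.1, p.2)) :=
  (Measure.measurePreserving_neg (volume : Measure ℝ)).prod (.id _)

lemma measurePreserving_neg_snd :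
    MeasurePreserving (fun p : ℝ × ℝ => (p.1, -p.2)) :=
  (MeasurePreserving.id (volume : Measure ℝ)).prod (Measure.measurePreserving_neg _)

lemma measurableEmbedding_neg_fst : MeasurableEmbedding (fun p : ℝ × ℝ => (-p.1, p.2)) :=
  ((MeasurableEquiv.neg ℝ).prodCongr (.refl ℝ)).measurableEmbedding

lemma measurableEmbedding_neg_snd : MeasurableEmbedding (fun p : ℝ × ℝ => (p.1, -p.2)) :=
  ((MeasurableEquiv.refl ℝ).prodCongr (.neg ℝ)).measurableEmbedding

lemma setIntegral_eq_zero_of_odd {Ω : Set (ℝ × ℝ)} {F : ℝ × ℝ → ℝ} (hΩ : MeasurableSet Ω)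
    {e : ℝ × ℝ → ℝ × ℝ} (he : MeasurePreserving e) (hm : MeasurableEmbedding e)
    (hinv : e ⁻¹' Ω = Ω) (hF : ∀ q ∈ Ω, F (e q) = -F q) : ∫ q in Ω, F q = 0 := by
  have h := he.setIntegral_preimage_emb hm F Ω
  rw [hinv, setIntegral_congr_fun hΩ hF, integral_neg] at h
  linarith

lemma XYSymmetric.preimage_neg_fst {Ω : Set (ℝ × ℝ)} {W : ℝ × ℝ → ℝ} (h : XYSymmetric Ω W) :
    (fun p : ℝ × ℝ => (-p.1, p.2)) ⁻¹' Ω = Ω := by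
  ext p
  refine ⟨fun hp => ?_, fun hp => (h.1 p hp).1⟩
  simpa using (h.1 _ hp).1

lemma XYSymmetric.preimage_neg_snd {Ω : Set (ℝ × ℝ)} {W : ℝ × ℝ → ℝ} (h : XYSymmetric Ω W) :
    (fun p : ℝ × ℝ => (p.1, -p.2)) ⁻¹' Ω = Ω := by
  ext p
  refine ⟨fun hp => ?_, fun hp => (h.1 p hp).2⟩
  simpa using (h.1 _ hp).2

lemma weightFunctional_eq_zero_of_odd_fst {Ω : Set (ℝ × ℝ)} {W : ℝ × ℝ → ℝ} (hW : IsWeight Ω W)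
    (hsym : XYSymmetric Ω W) {f : MvPolynomial (Fin 2) ℝ}
    (hf : ∀ p : ℝ × ℝ, ev (-p.1, p.2) f = -ev p f) : weightFunctional hW f = 0 :=
  setIntegral_eq_zero_of_odd hW.1 measurePreserving_neg_fst measurableEmbedding_neg_fst
    hsym.preimage_neg_fst fun q hq => by simp [hf, (hsym.2 q hq).1]

lemma weightFunctional_eq_zero_of_odd {Ω : Set (ℝ × ℝ)} {W : ℝ × ℝ → ℝ} (hW : IsWeight Ω W)
    (hsym : XYSymmetric Ω W) {f : MvPolynomial (Fin 2) ℝ}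
    (hf : ∀ p : ℝ × ℝ, ev (-p.1, -p.2) f = -ev p f) : weightFunctional hW f = 0 :=
  setIntegral_eq_zero_of_odd hW.1
    (measurePreserving_neg_fst.comp measurePreserving_neg_snd)
    (measurableEmbedding_neg_fst.comp measurableEmbedding_neg_snd)
    (by rw [Set.preimage_comp, hsym.preimage_neg_fst, hsym.preimage_neg_snd])
    fun q hq => by
      have h1 := (hsym.2 q hq).2
      have h2 := (hsym.2 _ (hsym.1 q hq).2).1
      simp only [Function.comp] at *
      rw [hf, h2, h1, neg_mul]

lemma volume_fst_eq_zero : volume {p : ℝ × ℝ | p.1 = 0} = 0 := by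
  have : {p : ℝ × ℝ | p.1 = 0} = ({0} : Set ℝ) ×ˢ Set.univ := by ext; simp
  rw [this, Measure.volume_eq_prod, Measure.prod_prod]
  simp

lemma volume_snd_eq_zero : volume {p : ℝ × ℝ | p.2 = 0} = 0 := by
  have : {p : ℝ × ℝ | p.2 = 0} = Set.univ ×ˢ ({0} : Set ℝ) := by ext; simp
  rw [this, Measure.volume_eq_prod, Measure.prod_prod]
  simp

/-- An integral over a set invariant under a reflection is twice the integral over one half. -/
lemma setIntegral_eq_two_mul_of_even {A H : Set (ℝ × ℝ)} {F : ℝ × ℝ → ℝ} (hA : MeasurableSet A)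
    (hH : MeasurableSet H) (hint : IntegrableOn F A)
    {e : ℝ × ℝ → ℝ × ℝ} (he : MeasurePreserving e) (hm : MeasurableEmbedding e)
    (hinv : e ⁻¹' A = A) (hF : ∀ q ∈ A, F (e q) = F q)
    (hHe : (e ⁻¹' H : Set (ℝ × ℝ)) =ᵐ[volume] (Hᶜ : Set (ℝ × ℝ))) :
    ∫ q in A, F q = 2 * ∫ q in A ∩ H, F q := by
  have h1 := integral_inter_add_sdiff hH hint
  have h2 := he.setIntegral_preimage_emb hm F (A ∩ H)
  rw [Set.preimage_inter, hinv] at h2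
  have h3 : ∫ q in A ∩ e ⁻¹' H, F (e q) = ∫ q in A ∩ e ⁻¹' H, F q :=
    setIntegral_congr_fun (hA.inter (he.measurable hH)) fun q hq => hF q hq.1
  have h4 : ∫ q in A ∩ e ⁻¹' H, F q = ∫ q in A \ H, F q :=
    setIntegral_congr_set ((ae_eq_refl A).inter hHe)
  rw [← h1, ← h4, ← h3, h2]
  ring

lemma setIntegral_eq_four_mul_quadrant {Ω : Set (ℝ × ℝ)} {F : ℝ × ℝ → ℝ} {W : ℝ × ℝ → ℝ}
    (hΩ : MeasurableSet Ω) (hsym : XYSymmetric Ω W) (hint : IntegrableOn F Ω)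
    (h1 : ∀ q ∈ Ω, F (-q.1, q.2) = F q) (h2 : ∀ q ∈ Ω, F (q.1, -q.2) = F q) :
    ∫ q in Ω, F q = 4 * ∫ q in Ω ∩ {p | 0 < p.1} ∩ {p | 0 < p.2}, F q := by
  have m1 : MeasurableSet {p : ℝ × ℝ | 0 < p.1} := measurableSet_lt measurable_const measurable_fst
  have m2 : MeasurableSet {p : ℝ × ℝ | 0 < p.2} := measurableSet_lt measurable_const measurable_snd
  rw [setIntegral_eq_two_mul_of_even hΩ m1 hint measurePreserving_neg_fst
      measurableEmbedding_neg_fst hsym.preimage_neg_fst h1,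
    setIntegral_eq_two_mul_of_even (hΩ.inter m1) m2 (hint.mono_set Set.inter_subset_left)
      measurePreserving_neg_snd measurableEmbedding_neg_snd
      (by rw [Set.preimage_inter, hsym.preimage_neg_snd]; rfl) (fun q hq => h2 q hq.1)]
  · ring
  · have : ∀ᵐ p : ℝ × ℝ, p.2 ≠ 0 := by
      rw [ae_iff]; simpa using volume_snd_eq_zero
    filter_upwards [this] with p hp
    apply propext
    change 0 < -p.2 ↔ ¬ 0 < p.2
    grind
  · have : ∀ᵐ p : ℝ × ℝ, p.1 ≠ 0 := by
      rw [ae_iff]; simpa using volume_fst_eq_zero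
    filter_upwards [this] with p hp
    apply propext
    change 0 < -p.1 ↔ ¬ 0 < p.1
    grind

lemma setIntegral_Ωstar_s17 {Ω : Set (ℝ × ℝ)} (hΩ : MeasurableSet Ω) (W H : ℝ × ℝ → ℝ) :
    ∫ z in Ωstar Ω, H z * W00 W z =
      ∫ q in Ω ∩ {p | 0 < p.1} ∩ {p | 0 < p.2}, H (q.1 ^ 2, q.2 ^ 2) * W q := by
  have m1 : MeasurableSet {p : ℝ × ℝ | 0 < p.1} := measurableSet_lt measurable_const measurable_fst
  have m2 : MeasurableSet {p : ℝ × ℝ | 0 < p.2} := measurableSet_lt measurable_const measurable_snd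
  set Q : Set (ℝ × ℝ) := Ω ∩ {p | 0 < p.1} ∩ {p | 0 < p.2}
  have hmQ : MeasurableSet Q := (hΩ.inter m1).inter m2
  let φ : ℝ × ℝ → ℝ × ℝ := fun q => (q.1 ^ 2, q.2 ^ 2)
  have himage : (Ωstar Ω : Set (ℝ × ℝ)) =ᵐ[volume] (φ '' Q : Set (ℝ × ℝ)) := by
    have a1 : ∀ᵐ p : ℝ × ℝ, p.1 ≠ 0 := by
      rw [ae_iff]; simpa using volume_fst_eq_zero
    have a2 : ∀ᵐ p : ℝ × ℝ, p.2 ≠ 0 := by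
      rw [ae_iff]; simpa using volume_snd_eq_zero
    filter_upwards [a1, a2] with p h1 h2
    apply propext
    constructor
    · rintro ⟨hu, hv, hp⟩
      refine ⟨(√p.1, √p.2), ⟨⟨hp, Real.sqrt_pos.2 (hu.lt_of_ne' h1)⟩,
        Real.sqrt_pos.2 (hv.lt_of_ne' h2)⟩, ?_⟩
      simp [φ, Real.sq_sqrt hu, Real.sq_sqrt hv]
    · rintro ⟨q, ⟨⟨hq, hx⟩, hy⟩, rfl⟩
      refine ⟨sq_nonneg _, sq_nonneg _, ?_⟩
      simpa [φ, Real.sqrt_sq (le_of_lt hx), Real.sqrt_sq (le_of_lt hy)] using hq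
  let φ' : ℝ × ℝ → (ℝ × ℝ →L[ℝ] ℝ × ℝ) := fun q =>
    ((2 * q.1) • ContinuousLinearMap.id ℝ ℝ).prodMap ((2 * q.2) • ContinuousLinearMap.id ℝ ℝ)
  have hdet : ∀ q, (φ' q).det = 4 * (q.1 * q.2) := by
    intro q
    have : ((φ' q : ℝ × ℝ →L[ℝ] ℝ × ℝ) : ℝ × ℝ →ₗ[ℝ] ℝ × ℝ) =
        ((2 * q.1) • LinearMap.id).prodMap ((2 * q.2) • LinearMap.id) := rfl
    rw [ContinuousLinearMap.det, this, LinearMap.det_prodMap]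
    simp
    ring
  have hderiv : ∀ q ∈ Q, HasFDerivWithinAt φ (φ' q) Q q := by
    intro q _
    have hsq (x : ℝ) :
        HasFDerivAt (fun x : ℝ => x ^ 2) ((2 * x) • ContinuousLinearMap.id ℝ ℝ) x := by
      refine (hasDerivAt_pow 2 x).hasFDerivAt.congr_fderiv ?_
      ext
      simp
    exact (HasFDerivAt.prodMap q (hsq q.1) (hsq q.2)).hasFDerivWithinAt
  have hinj : Set.InjOn φ Q := by
    rintro ⟨a, b⟩ ⟨⟨_, ha⟩, hb⟩ ⟨c, d⟩ ⟨⟨_, hc⟩, hd⟩ h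
    simp only [φ, Prod.mk.injEq, Set.mem_ofPred_eq] at *
    exact ⟨(pow_left_inj₀ ha.le hc.le two_ne_zero).1 h.1,
      (pow_left_inj₀ hb.le hd.le two_ne_zero).1 h.2⟩
  rw [setIntegral_congr_set himage,
    integral_image_eq_integral_abs_det_fderiv_smul volume hmQ hderiv hinj]
  refine setIntegral_congr_fun hmQ ?_
  rintro ⟨a, b⟩ ⟨⟨_, ha⟩, hb⟩
  simp only [Set.mem_ofPred_eq] at ha hb
  have hab : 0 < a * b := mul_pos ha hb
  simp only [hdet, W00, φ, smul_eq_mul, Real.sqrt_sq ha.le, Real.sqrt_sq hb.le, ← mul_pow,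
    Real.sqrt_sq hab.le]
  rw [abs_of_pos (by positivity)]
  field_simp

lemma setIntegral_Ωstar_eq_weightFunctional {Ω : Set (ℝ × ℝ)} {W : ℝ × ℝ → ℝ}
    (hW : IsWeight Ω W) (hsym : XYSymmetric Ω W) {f : MvPolynomial (Fin 2) ℝ} {H : ℝ × ℝ → ℝ}
    (hf : ∀ q : ℝ × ℝ, ev q f = H (q.1 ^ 2, q.2 ^ 2)) :
    ∫ z in Ωstar Ω, H z * W00 W z = (1 / 4) * weightFunctional hW f := by
  rw [weightFunctional_apply, setIntegral_eq_four_mul_quadrant hW.1 hsym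
    (integrableOn_ev_mul hW f), setIntegral_Ωstar_s17 hW.1]
  · simp only [hf]
    ring
  · intro q hq
    simp [hf, (hsym.2 q hq).1]
  · intro q hq
    simp [hf, (hsym.2 q hq).2]

/-- Bivariate polynomials all of whose monomials have total degree less than `n`. -/
def degLT (n : ℕ) : Submodule ℝ (MvPolynomial (Fin 2) ℝ) :=
  restrictSupport ℝ {d | d 0 + d 1 < n}

lemma degLT_mono {m n : ℕ} (h : m ≤ n) : degLT m ≤ degLT n :=
  restrictSupport_mono ℝ fun _ hd => lt_of_lt_of_le hd h

lemma X_pow_mul_X_pow_eq (a b : ℕ) : (X 0 ^ a * X 1 ^ b : MvPolynomial (Fin 2) ℝ) =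
    monomial (Finsupp.single 0 a + Finsupp.single 1 b) 1 := by
  rw [X_pow_eq_monomial, X_pow_eq_monomial, monomial_mul, one_mul]

lemma X_pow_mul_X_pow_mem_degLT {a b n : ℕ} (h : a + b < n) :
    (X 0 ^ a * X 1 ^ b : MvPolynomial (Fin 2) ℝ) ∈ degLT n := by
  rw [X_pow_mul_X_pow_eq]
  exact (monomial_mem_restrictSupport ℝ).2 (.inl (by simpa using h))

lemma X_mul_mem_degLT {f : MvPolynomial (Fin 2) ℝ} {n : ℕ} (κ : Fin 2) (h : f ∈ degLT n) :
    X κ * f ∈ degLT (n + 1) := by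
  have hle : degLT n ≤ (degLT (n + 1)).comap (LinearMap.mulLeft ℝ (X κ)) := by
    rw [degLT, restrictSupport_eq_span, Submodule.span_le]
    rintro _ ⟨d, hd, rfl⟩
    simp only [Set.mem_ofPred_eq] at hd
    change X κ * monomial d 1 ∈ degLT (n + 1)
    rw [X, monomial_mul]
    refine (monomial_mem_restrictSupport ℝ).2 (.inl ?_)
    fin_cases κ <;> simp <;> omega
  exact hle h

lemma MonicLead.sub_mem_degLT {n j : ℕ} {f : MvPolynomial (Fin 2) ℝ} (h : MonicLead n j f) :
    f - X 0 ^ (n - j) * X 1 ^ j ∈ degLT n := by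
  rcases h with h | h
  · rw [h, sub_self]
    exact Submodule.zero_mem _
  · refine (mem_restrictSupport_iff ℝ).2 fun d hd => ?_
    have := le_totalDegree hd
    rw [Finsupp.sum_fintype _ _ (by simp), Fin.sum_univ_two] at this
    exact lt_of_le_of_lt this h

/-- The index shift `i ↦ i + κ` describing the leading term of multiplication by `X κ`. -/
def shift (κ : Fin 2) {n : ℕ} (i : Fin n) : Fin (n + 1) := ⟨i + κ, by omega⟩

section MOPS

variable {Ω : Set (ℝ × ℝ)} {W : ℝ × ℝ → ℝ}
  {S : (n : ℕ) → Fin (n + 1) → MvPolynomial (Fin 2) ℝ}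

lemma IsMOPS.mem_degLT (hS : IsMOPS Ω W S) {m n : ℕ} (h : m < n) (j : Fin (m + 1)) :
    S m j ∈ degLT n := by
  have h1 := degLT_mono h.le (hS.1 m j).sub_mem_degLT
  have h2 : (X 0 ^ (m - j) * X 1 ^ (j : ℕ) : MvPolynomial (Fin 2) ℝ) ∈ degLT n :=
    X_pow_mul_X_pow_mem_degLT (by omega)
  simpa using Submodule.add_mem _ h1 h2

lemma IsMOPS.degLT_le_span (hS : IsMOPS Ω W S) (n : ℕ) :
    degLT n ≤ Submodule.span ℝ {f | ∃ m, m < n ∧ ∃ j, f = S m j} := by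
  induction n with
  | zero =>
    intro f hf
    have : f = 0 := by
      ext d
      revert d
      simpa [degLT, mem_restrictSupport_iff, Set.subset_def] using hf
    rw [this]
    exact Submodule.zero_mem _
  | succ n ih =>
    have hmono := ih.trans (Submodule.span_mono (t := {f | ∃ m, m < n + 1 ∧ ∃ j, f = S m j})
      fun f ⟨m, hm, j, hf⟩ => ⟨m, by omega, j, hf⟩)
    rw [degLT, restrictSupport_eq_span, Submodule.span_le]
    rintro _ ⟨d, hd, rfl⟩
    simp only [Set.mem_ofPred_eq] at hd
    have hd' : d = Finsupp.single 0 (d 0) + Finsupp.single 1 (d 1) := by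
      ext i
      fin_cases i <;> simp
    simp only [SetLike.mem_coe]
    rw [hd', ← X_pow_mul_X_pow_eq]
    rcases Nat.lt_succ_iff_lt_or_eq.1 hd with h | h
    · exact hmono (X_pow_mul_X_pow_mem_degLT h)
    · have h1 := hmono (hS.1 n ⟨d 1, by omega⟩).sub_mem_degLT
      have h2 : S n ⟨d 1, by omega⟩ ∈
          Submodule.span ℝ {f | ∃ m, m < n + 1 ∧ ∃ j, f = S m j} :=
        Submodule.subset_span ⟨n, by omega, _, rfl⟩
      have h3 := Submodule.sub_mem _ h2 h1
      rw [sub_sub_cancel] at h3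
      have : n - d 1 = d 0 := by omega
      simpa [this] using h3

lemma IsMOPS.weightFunctional_mul_eq_zero (hS : IsMOPS Ω W S) (hW : IsWeight Ω W) {n : ℕ}
    {f g : MvPolynomial (Fin 2) ℝ} (hg : ∀ m < n, ∀ j, weightFunctional hW (g * S m j) = 0)
    (hf : f ∈ degLT n) : weightFunctional hW (g * f) = 0 := by
  have hle : Submodule.span ℝ {f | ∃ m, m < n ∧ ∃ j, f = S m j} ≤
      LinearMap.ker (weightFunctional hW ∘ₗ LinearMap.mulLeft ℝ g) := by
    rw [Submodule.span_le]
    rintro _ ⟨m, hm, j, rfl⟩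
    exact hg m hm j
  exact hle (hS.degLT_le_span n hf)

lemma IsMOPS.weightFunctional_mul_of_ne (hS : IsMOPS Ω W S) (hW : IsWeight Ω W) {m n : ℕ}
    (h : m ≠ n) (i : Fin (m + 1)) (j : Fin (n + 1)) :
    weightFunctional hW (S m i * S n j) = 0 := by
  rw [weightFunctional_mul]
  exact hS.2 m n h i j

lemma IsMOPS.weightFunctional_mul_of_mem_degLT (hS : IsMOPS Ω W S) (hW : IsWeight Ω W) {n : ℕ}
    {f : MvPolynomial (Fin 2) ℝ} (i : Fin (n + 1)) (hf : f ∈ degLT n) :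
    weightFunctional hW (S n i * f) = 0 :=
  hS.weightFunctional_mul_eq_zero hW
    (fun m hm j => hS.weightFunctional_mul_of_ne hW (by omega) i j) hf

lemma IsMOPS.X_mul_sub_mem_degLT (hS : IsMOPS Ω W S) (κ : Fin 2) {n : ℕ} (i : Fin (n + 1)) :
    X κ * S n i - S (n + 1) (shift κ i) ∈ degLT (n + 1) := by
  have h1 := X_mul_mem_degLT κ (hS.1 n i).sub_mem_degLT
  have h2 := (hS.1 (n + 1) (shift κ i)).sub_mem_degLT
  convert Submodule.sub_mem _ h1 h2 using 1
  have h3 : (X κ * (X 0 ^ (n - i) * X 1 ^ (i : ℕ)) : MvPolynomial (Fin 2) ℝ) =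
      X 0 ^ (n + 1 - shift κ i) * X 1 ^ (shift κ i : ℕ) := by
    have := i.is_le
    fin_cases κ
    · simp [shift, Nat.sub_add_comm this, pow_succ']
      ring
    · simp [shift, pow_succ]
      ring
  rw [mul_sub, h3]
  ring

/-- The Gram matrix form of the three-term relation `xₖ Sₙ = L Sₙ₊₁ + Γ Sₙ₋₁`. -/
lemma IsMOPS.weightFunctional_X_mul_mul_X_mul (hS : IsMOPS Ω W S) (hW : IsWeight Ω W)
    (κ : Fin 2) {n : ℕ}
    (hodd : ∀ i j, weightFunctional hW (X κ * S (n + 1) i * S (n + 1) j) = 0)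
    {c : Fin (n + 2) → Fin (n + 1) → ℝ}
    (hc : ∀ i p, ∑ l, c i l * weightFunctional hW (S n l * S n p) =
      weightFunctional hW (S (n + 1) i * S (n + 1) (shift κ p))) (i j : Fin (n + 2)) :
    weightFunctional hW ((X κ * S (n + 1) i) * (X κ * S (n + 1) j)) =
      weightFunctional hW (S (n + 2) (shift κ i) * S (n + 2) (shift κ j)) +
      ∑ l, c i l * weightFunctional hW (S (n + 1) (shift κ l) * S (n + 1) j) := by
  set q : Fin (n + 2) → MvPolynomial (Fin 2) ℝ :=
    fun i => X κ * S (n + 1) i - S (n + 2) (shift κ i) with hq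
  have hqmem : ∀ i, q i ∈ degLT (n + 2) := fun i => hS.X_mul_sub_mem_degLT κ i
  have hXS : ∀ i, X κ * S (n + 1) i = S (n + 2) (shift κ i) + q i := fun i => by simp [hq]
  have horth : ∀ i j, weightFunctional hW (S (n + 2) i * q j) = 0 := fun i j =>
    hS.weightFunctional_mul_of_mem_degLT hW i (hqmem j)
  have hqS : ∀ i m (_ : m < n + 2) (p : Fin (m + 1)), weightFunctional hW (q i * S m p) =
      weightFunctional hW (S (n + 1) i * (X κ * S m p)) := by
    intro i m hm p
    have h1 : q i * S m p = S (n + 1) i * (X κ * S m p) - S (n + 2) (shift κ i) * S m p := by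
      simp only [hq]
      ring
    rw [h1, map_sub, hS.weightFunctional_mul_of_ne hW (by omega), sub_zero]
  have hqn : ∀ i p, weightFunctional hW (q i * S n p) =
      weightFunctional hW (S (n + 1) i * S (n + 1) (shift κ p)) := by
    intro i p
    have h1 := hS.weightFunctional_mul_of_mem_degLT hW i (hS.X_mul_sub_mem_degLT κ p)
    rw [mul_sub, map_sub, sub_eq_zero] at h1
    rw [hqS i n (by omega), h1]
  have hqq : weightFunctional hW ((q i - ∑ l, c i l • S n l) * q j) = 0 := by
    refine hS.weightFunctional_mul_eq_zero hW (fun m hm p => ?_) (hqmem j)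
    have hsum : weightFunctional hW ((∑ l, c i l • S n l) * S m p) =
        ∑ l, c i l * weightFunctional hW (S n l * S m p) := by
      simp [Finset.sum_mul]
    rw [sub_mul, map_sub, hsum]
    rcases eq_or_ne m n with rfl | hmn
    · rw [hc, hqn, sub_self]
    · rw [Finset.sum_eq_zero fun l _ => by
        rw [hS.weightFunctional_mul_of_ne hW hmn.symm, mul_zero], sub_zero, hqS i m hm]
      rcases (show m = n + 1 ∨ m < n by omega) with rfl | hm'
      · rw [← hodd i p]
        congr 1
        ring
      · exact hS.weightFunctional_mul_of_mem_degLT hW i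
          (degLT_mono (by omega) (X_mul_mem_degLT κ (hS.mem_degLT (Nat.lt_succ_self m) p)))
  have hsum : weightFunctional hW ((∑ l, c i l • S n l) * q j) =
      ∑ l, c i l * weightFunctional hW (S (n + 1) (shift κ l) * S (n + 1) j) := by
    simp only [Finset.sum_mul, smul_mul_assoc, map_sum, map_smul, smul_eq_mul]
    refine Finset.sum_congr rfl fun l _ => ?_
    rw [mul_comm (S n l), hqn, mul_comm (S (n + 1) j)]
  rw [sub_mul, map_sub, sub_eq_zero, hsum] at hqq
  rw [hXS, hXS, ← hqq, add_mul, mul_add, mul_add, mul_comm (q i) (S _ _)]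
  simp only [map_add, horth]
  ring

end MOPS

/-- The index map `i ↦ 2 i + c` onto the even (`c = 0`) or odd (`c = 1`) positions. -/
def interlace (c : Fin 2) {n : ℕ} (i : Fin (n + 1)) : Fin (2 * n + 2) := ⟨2 * i + c, by omega⟩

lemma Lmat_eq (n : ℕ) (κ : Fin 2) :
    Lmat n (κ + 1) = (1 : Matrix (Fin (n + 2)) (Fin (n + 2)) ℝ).submatrix (shift κ) id := by
  ext i j
  simp only [Lmat, shift, Matrix.of_apply, Matrix.submatrix_apply, Matrix.one_apply, id,
    Fin.ext_iff, add_tsub_cancel_right, eq_comm]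

lemma Jmat_eq (n : ℕ) (c : Fin 2) : Jmat (n + 1) (2 * n + 2) c =
    (1 : Matrix (Fin (2 * n + 2)) (Fin (2 * n + 2)) ℝ).submatrix (interlace c) id := by
  ext i j
  simp only [Jmat, interlace, Matrix.of_apply, Matrix.submatrix_apply, Matrix.one_apply, id,
    Fin.ext_iff, eq_comm]

lemma Lmat_mul {ι : Type*} (n : ℕ) (κ : Fin 2) (M : Matrix (Fin (n + 2)) ι ℝ) :
    Lmat n (κ + 1) * M = M.submatrix (shift κ) id := by
  ext i j
  simp [Lmat_eq, Matrix.mul_apply, Matrix.one_apply]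

section Gram

open Matrix

lemma Jmat_mul {ι : Type*} (n : ℕ) (c : Fin 2) (M : Matrix (Fin (2 * n + 2)) ι ℝ) :
    Jmat (n + 1) (2 * n + 2) c * M = M.submatrix (interlace c) id := by
  ext i j
  simp [Jmat_eq, Matrix.mul_apply, Matrix.one_apply]

lemma mul_Lmat_transpose {ι : Type*} (n : ℕ) (κ : Fin 2) (M : Matrix ι (Fin (n + 2)) ℝ) :
    M * (Lmat n (κ + 1))ᵀ = M.submatrix id (shift κ) := by
  rw [← Matrix.transpose_transpose M, ← Matrix.transpose_mul, Lmat_mul]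
  rfl

lemma mul_Jmat_transpose {ι : Type*} (n : ℕ) (c : Fin 2) (M : Matrix ι (Fin (2 * n + 2)) ℝ) :
    M * (Jmat (n + 1) (2 * n + 2) c)ᵀ = M.submatrix id (interlace c) := by
  rw [← Matrix.transpose_transpose M, ← Matrix.transpose_mul, Jmat_mul]
  rfl

/-- If `G` has no entries between indices of different parity, then its columns in the positions
`2 j + c` are supported on the positions `2 i + c`. -/
lemma mul_Jmat_transpose_eq {n : ℕ} (c : Fin 2) {G : Matrix (Fin (2 * n + 2)) (Fin (2 * n + 2)) ℝ}
    {R : Matrix (Fin (n + 1)) (Fin (n + 1)) ℝ}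
    (hR : ∀ i j, R i j = (1 / 4) * G (interlace c i) (interlace c j))
    (hpar : ∀ a b : Fin (2 * n + 2), (a : ℕ) % 2 ≠ b % 2 → G a b = 0) :
    G * (Jmat (n + 1) (2 * n + 2) c)ᵀ = (4 : ℝ) • ((Jmat (n + 1) (2 * n + 2) c)ᵀ * R) := by
  rw [mul_Jmat_transpose]
  ext a j
  have hc := c.isLt
  simp only [submatrix_apply, id, Matrix.smul_apply, mul_apply, transpose_apply, Jmat, of_apply,
    smul_eq_mul, ite_mul, one_mul, zero_mul]
  by_cases ha : (a : ℕ) % 2 = c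
  · have hi : a = interlace c (⟨a / 2, by omega⟩ : Fin (n + 1)) := by
      ext
      simp only [interlace]
      omega
    rw [Finset.sum_eq_single (⟨a / 2, by omega⟩ : Fin (n + 1)), if_pos, hR, ← hi]
    · ring
    · simp only; omega
    · intro b _ hb
      rw [if_neg]
      intro h
      exact hb (Fin.ext (by simp only; omega))
    · simp
  · rw [hpar a _ (by simp only [interlace]; omega), Finset.sum_eq_zero, mul_zero]
    intro b _
    rw [if_neg]
    omega

lemma Jmat_mul_eq {n : ℕ} (c : Fin 2) {G : Matrix (Fin (2 * n + 2)) (Fin (2 * n + 2)) ℝ}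
    {R : Matrix (Fin (n + 1)) (Fin (n + 1)) ℝ} (hG : Gᵀ = G)
    (hR : ∀ i j, R i j = (1 / 4) * G (interlace c i) (interlace c j))
    (hpar : ∀ a b : Fin (2 * n + 2), (a : ℕ) % 2 ≠ b % 2 → G a b = 0) :
    Jmat (n + 1) (2 * n + 2) c * G = (4 : ℝ) • (R * Jmat (n + 1) (2 * n + 2) c) := by
  have hRt : Rᵀ = R := by
    ext i j
    rw [transpose_apply, hR, hR, ← hG, transpose_apply, hG]
  have h := congrArg transpose (mul_Jmat_transpose_eq c hR hpar)
  simpa [hG, hRt] using h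

lemma Jmat_mul_Lmat_transpose_mul_Lmat_transpose (m : ℕ) (c κ : Fin 2) :
    Jmat (m + 2) (2 * m + 4) c * ((Lmat (2 * m + 2) (κ + 1))ᵀ * (Lmat (2 * m + 1) (κ + 1))ᵀ *
      (Jmat (m + 1) (2 * m + 2) c)ᵀ) = (Lmat m (κ + 1))ᵀ := by
  rw [mul_Jmat_transpose, mul_Lmat_transpose]
  refine (Jmat_mul (m + 1) c _).trans ?_
  ext i j
  simp only [submatrix_apply, transpose_apply, Lmat, shift, interlace, of_apply, id]
  congr 1
  simp only [eq_iff_iff]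
  omega

lemma mul_mul_eq_of_intertwining {α α' β β' γ : Type*} [Fintype α] [Fintype α'] [Fintype β]
    [Fintype β'] [Fintype γ] {A' : Matrix α' α' ℝ} {A : Matrix α α ℝ}
    {J' : Matrix α' β' ℝ} {J : Matrix β α ℝ} {S' : Matrix β' β' ℝ} {S : Matrix β β ℝ}
    {L₂ : Matrix β' γ ℝ} {L₁ : Matrix γ β ℝ} {L : Matrix α' α ℝ}
    (hJS : J' * S' = (4 : ℝ) • (A' * J')) (hSJ : S * J = (1 / 4 : ℝ) • (J * A))
    (hL : J' * (L₂ * L₁ * J) = L) : A' * L * A = J' * (S' * L₂ * (L₁ * S)) * J := by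
  calc A' * L * A = (4 : ℝ) • (A' * J') * (L₂ * L₁ * ((1 / 4 : ℝ) • (J * A))) := by
        simp only [← hL, Matrix.mul_assoc, smul_mul, Matrix.mul_smul, smul_smul]
        norm_num
    _ = _ := by simp only [← hJS, ← hSJ, Matrix.mul_assoc]

variable {Smat : (n : ℕ) → Matrix (Fin (n + 1)) (Fin (n + 1)) ℝ}
  {Γp : (m : ℕ) → ℕ → Matrix (Fin (m + 2)) (Fin (m + 1)) ℝ}
  {R : (n : ℕ) → Matrix (Fin (n + 1)) (Fin (n + 1)) ℝ}

lemma gram_lower_relation (hSt : ∀ n, (Smat n)ᵀ = Smat n) (hSdet : ∀ n, IsUnit (Smat n).det)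
    (hΓ : ∀ m k, Γp m k = Smat (m + 1) * (Lmat m k)ᵀ * (Smat m)⁻¹)
    (c κ : Fin 2) (hRdet : ∀ n, IsUnit (R n).det)
    (hR : ∀ n i j, R n i j = (1 / 4) * Smat (2 * n + 1) (interlace c i) (interlace c j))
    (hpar : ∀ n (a b : Fin (2 * n + 2)), (a : ℕ) % 2 ≠ b % 2 → Smat (2 * n + 1) a b = 0) (m : ℕ) :
    R (m + 1) * (Lmat m (κ + 1))ᵀ * (R m)⁻¹ =
      Jmat (m + 2) (2 * m + 4) c * (Γp (2 * m + 2) (κ + 1) * Γp (2 * m + 1) (κ + 1)) *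
        (Jmat (m + 1) (2 * m + 2) c)ᵀ := by
  have hJS : Jmat (m + 2) (2 * m + 4) c * Smat (2 * m + 3) =
      (4 : ℝ) • (R (m + 1) * Jmat (m + 2) (2 * m + 4) c) :=
    Jmat_mul_eq c (hSt (2 * m + 3)) (hR (m + 1)) (hpar (m + 1))
  have hSJ := mul_Jmat_transpose_eq c (hR m) (hpar m)
  have hΓΓ : Γp (2 * m + 2) (κ + 1) * Γp (2 * m + 1) (κ + 1) =
      Smat (2 * m + 3) * (Lmat (2 * m + 2) (κ + 1))ᵀ *
        ((Lmat (2 * m + 1) (κ + 1))ᵀ * (Smat (2 * m + 1))⁻¹) := by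
    rw [hΓ, hΓ, Matrix.mul_assoc (Smat (2 * m + 1 + 1)) _ _]
    exact (Matrix.mul_assoc _ _ _).trans
      (congrArg _ (nonsing_inv_mul_cancel_left _ _ (hSdet (2 * m + 2))))
  have hJR : (Smat (2 * m + 1))⁻¹ * (Jmat (m + 1) (2 * m + 2) c)ᵀ =
      (1 / 4 : ℝ) • ((Jmat (m + 1) (2 * m + 2) c)ᵀ * (R m)⁻¹) := by
    have h1 : (Jmat (m + 1) (2 * m + 2) c)ᵀ =
        (1 / 4 : ℝ) • (Smat (2 * m + 1) * (Jmat (m + 1) (2 * m + 2) c)ᵀ * (R m)⁻¹) := by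
      rw [hSJ, smul_mul, mul_nonsing_inv_cancel_right _ _ (hRdet m), smul_smul]
      norm_num
    conv_lhs => rw [h1]
    rw [Matrix.mul_smul, Matrix.mul_assoc, nonsing_inv_mul_cancel_left _ _ (hSdet (2 * m + 1))]
  rw [hΓΓ]
  exact mul_mul_eq_of_intertwining hJS hJR (Jmat_mul_Lmat_transpose_mul_Lmat_transpose m c κ)

lemma gram_diagonal_relation (hSdet : ∀ n, IsUnit (Smat n).det)
    (hΓ : ∀ m k, Γp m k = Smat (m + 1) * (Lmat m k)ᵀ * (Smat m)⁻¹)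
    (c κ : Fin 2) (hRdet : ∀ n, IsUnit (R n).det)
    (hR : ∀ n i j, R n i j = (1 / 4) * Smat (2 * n + 1) (interlace c i) (interlace c j))
    (hpar : ∀ n (a b : Fin (2 * n + 2)), (a : ℕ) % 2 ≠ b % 2 → Smat (2 * n + 1) a b = 0) (n : ℕ)
    {D : Matrix (Fin (n + 1)) (Fin (n + 1)) ℝ}
    (hD : ∀ i j, D i j = (1 / 4) * (Smat (2 * n + 2) (shift κ (interlace c i))
      (shift κ (interlace c j)) + ∑ l, Γp (2 * n) (κ + 1) (interlace c i) l *
        Smat (2 * n + 1) (shift κ l) (interlace c j))) :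
    D * (R n)⁻¹ = Jmat (n + 1) (2 * n + 2) c *
        (Lmat (2 * n + 1) (κ + 1) * Γp (2 * n + 1) (κ + 1) +
          Γp (2 * n) (κ + 1) * Lmat (2 * n) (κ + 1)) *
        (Jmat (n + 1) (2 * n + 2) c)ᵀ := by
  have hSJ := mul_Jmat_transpose_eq c (hR n) (hpar n)
  have hBS : (Lmat (2 * n + 1) (κ + 1) * Γp (2 * n + 1) (κ + 1) +
        Γp (2 * n) (κ + 1) * Lmat (2 * n) (κ + 1)) * Smat (2 * n + 1) =
      (Smat (2 * n + 2)).submatrix (shift κ) (shift κ) +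
        Γp (2 * n) (κ + 1) * (Smat (2 * n + 1)).submatrix (shift κ) id := by
    rw [add_mul, Matrix.mul_assoc, Matrix.mul_assoc, Lmat_mul (2 * n), hΓ (2 * n + 1),
      nonsing_inv_mul_cancel_right _ _ (hSdet (2 * n + 1)), Lmat_mul, mul_Lmat_transpose]
    rfl
  have hDJ : D = (1 / 4 : ℝ) • (Jmat (n + 1) (2 * n + 2) c *
      ((Lmat (2 * n + 1) (κ + 1) * Γp (2 * n + 1) (κ + 1) +
        Γp (2 * n) (κ + 1) * Lmat (2 * n) (κ + 1)) * Smat (2 * n + 1)) *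
      (Jmat (n + 1) (2 * n + 2) c)ᵀ) := by
    rw [hBS, Jmat_mul, mul_Jmat_transpose]
    ext i j
    rw [hD]
    simp [mul_apply]
  rw [hDJ, ← Matrix.mul_assoc (Jmat _ _ _), Matrix.mul_assoc _ (Smat _), hSJ, Matrix.mul_smul,
    smul_smul, ← Matrix.mul_assoc, smul_mul, mul_nonsing_inv_cancel_right _ _ (hRdet n)]
  norm_num

end Gram

section Backlund

open Matrix

variable {Ω : Set (ℝ × ℝ)} {W : ℝ × ℝ → ℝ}
  {S : (n : ℕ) → Fin (n + 1) → MvPolynomial (Fin 2) ℝ}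
  {t : Fin 2 → (n : ℕ) → Fin (n + 1) → MvPolynomial (Fin 2) ℝ}

lemma exists_eq_interlace {n : ℕ} (a : Fin (2 * n + 2)) :
    ∃ (c : Fin 2) (j : Fin (n + 1)), a = interlace c j :=
  ⟨⟨a % 2, by omega⟩, ⟨a / 2, by omega⟩, Fin.ext (by simp only [interlace]; omega)⟩

lemma ev_neg_neg_of_interlace
    (ht : ∀ c n j p, ev p (S (2 * n + 1) (interlace c j)) =
      ![p.1, p.2] c * ev (p.1 ^ 2, p.2 ^ 2) (t c n j)) (n : ℕ) (a : Fin (2 * n + 2)) (p : ℝ × ℝ) :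
    ev (-p.1, -p.2) (S (2 * n + 1) a) = -ev p (S (2 * n + 1) a) := by
  obtain ⟨c, j, rfl⟩ := exists_eq_interlace a
  rw [ht, ht]
  fin_cases c <;> simp

lemma weightFunctional_mul_eq_zero_of_parity (hW : IsWeight Ω W) (hsym : XYSymmetric Ω W)
    (ht : ∀ c n j p, ev p (S (2 * n + 1) (interlace c j)) =
      ![p.1, p.2] c * ev (p.1 ^ 2, p.2 ^ 2) (t c n j)) (n : ℕ) (a b : Fin (2 * n + 2))
    (hab : (a : ℕ) % 2 ≠ b % 2) :
    weightFunctional hW (S (2 * n + 1) a * S (2 * n + 1) b) = 0 := by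
  refine weightFunctional_eq_zero_of_odd_fst hW hsym fun p => ?_
  obtain ⟨c, i, rfl⟩ := exists_eq_interlace a
  obtain ⟨d, j, rfl⟩ := exists_eq_interlace b
  have hmul : ∀ (q : ℝ × ℝ) (f g : MvPolynomial (Fin 2) ℝ), ev q (f * g) = ev q f * ev q g :=
    fun q f g => by simp [ev]
  rw [hmul, hmul, ht, ht, ht, ht]
  fin_cases c <;> fin_cases d <;> simp [interlace] at hab ⊢

lemma backlund_relations (hW : IsWeight Ω W) (hsym : XYSymmetric Ω W) (hS : IsMOPS Ω W S)
    {Smat : (n : ℕ) → Matrix (Fin (n + 1)) (Fin (n + 1)) ℝ}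
    (hSmat : ∀ (n : ℕ) (i j : Fin (n + 1)),
      Smat n i j = ∫ q in Ω, ev q (S n i) * ev q (S n j) * W q)
    (hSdet : ∀ n : ℕ, IsUnit (Smat n).det)
    {Γp : (m : ℕ) → ℕ → Matrix (Fin (m + 2)) (Fin (m + 1)) ℝ}
    (hΓ : ∀ (m k : ℕ), Γp m k = Smat (m + 1) * (Lmat m k)ᵀ * (Smat m)⁻¹)
    (ht : ∀ c n j p, ev p (S (2 * n + 1) (interlace c j)) =
      ![p.1, p.2] c * ev (p.1 ^ 2, p.2 ^ 2) (t c n j)) (c κ : Fin 2)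
    {R : (n : ℕ) → Matrix (Fin (n + 1)) (Fin (n + 1)) ℝ}
    (hR : ∀ (n : ℕ) (i j : Fin (n + 1)), R n i j =
      ∫ z in Ωstar Ω, ev z (t c n i) * ev z (t c n j) * (![z.1, z.2] c * W00 W z))
    (hRdet : ∀ n : ℕ, IsUnit (R n).det) :
    (∀ n : ℕ,
      (Matrix.of fun i j : Fin (n + 1) =>
        ∫ z in Ωstar Ω, ![z.1, z.2] κ *
          (ev z (t c n i) * ev z (t c n j) * (![z.1, z.2] c * W00 W z))) * (R n)⁻¹ =
      Jmat (n + 1) (2 * n + 2) c *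
        (Lmat (2 * n + 1) (κ + 1) * Γp (2 * n + 1) (κ + 1) +
          Γp (2 * n) (κ + 1) * Lmat (2 * n) (κ + 1)) *
        (Jmat (n + 1) (2 * n + 2) c)ᵀ) ∧
    (∀ m : ℕ,
      R (m + 1) * (Lmat m (κ + 1))ᵀ * (R m)⁻¹ =
      Jmat (m + 2) (2 * m + 4) c * (Γp (2 * m + 2) (κ + 1) * Γp (2 * m + 1) (κ + 1)) *
        (Jmat (m + 1) (2 * m + 2) c)ᵀ) := by
  have hSΛ : ∀ n i j, Smat n i j = weightFunctional hW (S n i * S n j) := fun n i j => by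
    rw [hSmat, weightFunctional_mul]
  have hSt : ∀ n, (Smat n)ᵀ = Smat n := fun n => by
    ext i j
    rw [transpose_apply, hSΛ, hSΛ, mul_comm]
  have hpar : ∀ n (a b : Fin (2 * n + 2)), (a : ℕ) % 2 ≠ b % 2 → Smat (2 * n + 1) a b = 0 :=
    fun n a b hab => by
      rw [hSΛ, weightFunctional_mul_eq_zero_of_parity hW hsym ht n a b hab]
  have hsq : ∀ (d : Fin 2) (p : ℝ × ℝ), ![p.1 ^ 2, p.2 ^ 2] d = ![p.1, p.2] d ^ 2 := fun d p => by
    fin_cases d <;> rfl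
  have hmul : ∀ (q : ℝ × ℝ) (f g : MvPolynomial (Fin 2) ℝ), ev q (f * g) = ev q f * ev q g :=
    fun q f g => by simp [ev]
  have hX : ∀ (q : ℝ × ℝ) (d : Fin 2), ev q (X d) = ![q.1, q.2] d := fun q d => by simp [ev]
  have hR' : ∀ n i j,
      R n i j = (1 / 4) * Smat (2 * n + 1) (interlace c i) (interlace c j) := fun n i j => by
    rw [hR, hSΛ, ← setIntegral_Ωstar_eq_weightFunctional hW hsym
      (H := fun z => ev z (t c n i) * ev z (t c n j) * ![z.1, z.2] c)]
    · simp only [mul_assoc]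
    · intro q
      simp only [hmul, ht, hsq]
      ring
  refine ⟨fun n => gram_diagonal_relation hSdet hΓ c κ hRdet hR' hpar n fun i j => ?_,
    gram_lower_relation hSt hSdet hΓ c κ hRdet hR' hpar⟩
  have hodd : ∀ i j,
      weightFunctional hW (X κ * S (2 * n + 1) i * S (2 * n + 1) j) = 0 := fun i j => by
    refine weightFunctional_eq_zero_of_odd hW hsym fun p => ?_
    simp only [hmul, hX, ev_neg_neg_of_interlace ht]
    fin_cases κ <;> simp
  have hc : ∀ i p, ∑ l, Γp (2 * n) (κ + 1) i l * weightFunctional hW (S (2 * n) l * S (2 * n) p) =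
      weightFunctional hW (S (2 * n + 1) i * S (2 * n + 1) (shift κ p)) := fun i p => by
    have h : Γp (2 * n) (κ + 1) * Smat (2 * n) = (Smat (2 * n + 1)).submatrix id (shift κ) := by
      rw [hΓ, nonsing_inv_mul_cancel_right _ _ (hSdet (2 * n)), mul_Lmat_transpose]
    have h' := congrFun (congrFun h i) p
    rw [mul_apply] at h'
    simpa only [hSΛ, submatrix_apply, id] using h'
  simp only [hSΛ]
  rw [← hS.weightFunctional_X_mul_mul_X_mul hW κ hodd hc, of_apply,
    ← setIntegral_Ωstar_eq_weightFunctional hW hsym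
      (H := fun z => ![z.1, z.2] κ * (ev z (t c n i) * ev z (t c n j) * ![z.1, z.2] c))]
  · simp only [mul_assoc]
  · intro q
    simp only [hmul, ht, hX, hsq]
    ring

end Backlund

open Matrix in
/-- Bäcklund-type relations for the families `{P̂ₙ^(1,0)}` and `{P̂ₙ^(0,1)}`
(cases `(i,j) = (1,0), (0,1)` of Theorem `Backlund`): with
`Γ_{n,k} = 𝐒ₙ L_{n-1,k}ᵀ 𝐒_{n-1}⁻¹` (here `Γp m k = Γ_{m+1,k}`), for all `n ≥ 0`
`D̂_{n,k}^(1,0) = J_n⁽¹'⁰⁾ [L_{2n+1,k} Γ_{2n+2,k} + Γ_{2n+1,k} L_{2n,k}] (J_n⁽¹'⁰⁾)ᵀ`,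
`D̂_{n,k}^(0,1) = J_n⁽⁰'¹⁾ [L_{2n+1,k} Γ_{2n+2,k} + Γ_{2n+1,k} L_{2n,k}] (J_n⁽⁰'¹⁾)ᵀ`,
and for `n = m + 1 ≥ 1`
`Ĉ_{n,k}^(1,0) = J_n⁽¹'⁰⁾ Γ_{2n+1,k} Γ_{2n,k} (J_{n-1}⁽¹'⁰⁾)ᵀ`,
`Ĉ_{n,k}^(0,1) = J_n⁽⁰'¹⁾ Γ_{2n+1,k} Γ_{2n,k} (J_{n-1}⁽⁰'¹⁾)ᵀ`,
where `D̂` and `Ĉ` are formed from the Gram matrices `𝐑̂ₙ`, `𝐒̂ₙ` of the two families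
with respect to the weights `W⁽¹'⁰⁾`, `W⁽⁰'¹⁾` as in the other cases. -/
theorem stmt17 (Ω : Set (ℝ × ℝ)) (W : ℝ × ℝ → ℝ) (hW : IsWeight Ω W)
    (hsym : XYSymmetric Ω W)
    (S : (n : ℕ) → Fin (n + 1) → MvPolynomial (Fin 2) ℝ) (hS : IsMOPS Ω W S)
    (Smat : (n : ℕ) → Matrix (Fin (n + 1)) (Fin (n + 1)) ℝ)
    (hSmat : ∀ (n : ℕ) (i j : Fin (n + 1)),
      Smat n i j = ∫ q in Ω, ev q (S n i) * ev q (S n j) * W q)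
    (hSdet : ∀ n : ℕ, IsUnit (Smat n).det)
    (Γp : (m : ℕ) → ℕ → Matrix (Fin (m + 2)) (Fin (m + 1)) ℝ)
    (hΓ : ∀ (m kk : ℕ), Γp m kk = Smat (m + 1) * (Lmat m kk)ᵀ * (Smat m)⁻¹)
    (r s : (n : ℕ) → Fin (n + 1) → MvPolynomial (Fin 2) ℝ)
    (hrelr : ∀ (n : ℕ) (j : Fin (n + 1)) (x y : ℝ),
      eval ![x, y] (S (2 * n + 1) ⟨2 * (j : ℕ), by have := j.isLt; omega⟩) =
        x * eval ![x ^ 2, y ^ 2] (r n j))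
    (hrels : ∀ (n : ℕ) (j : Fin (n + 1)) (x y : ℝ),
      eval ![x, y] (S (2 * n + 1) ⟨2 * (j : ℕ) + 1, by have := j.isLt; omega⟩) =
        y * eval ![x ^ 2, y ^ 2] (s n j))
    (Rmat Tmat : (n : ℕ) → Matrix (Fin (n + 1)) (Fin (n + 1)) ℝ)
    (hRmat : ∀ (n : ℕ) (i j : Fin (n + 1)),
      Rmat n i j = ∫ z in Ωstar Ω, ev z (r n i) * ev z (r n j) * (z.1 * W00 W z))
    (hTmat : ∀ (n : ℕ) (i j : Fin (n + 1)),
      Tmat n i j = ∫ z in Ωstar Ω, ev z (s n i) * ev z (s n j) * (z.2 * W00 W z))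
    (hRdet : ∀ n : ℕ, IsUnit (Rmat n).det)
    (hTdet : ∀ n : ℕ, IsUnit (Tmat n).det)
    (k : ℕ) (hk : k = 1 ∨ k = 2) :
    (∀ n : ℕ,
      (Matrix.of fun i j : Fin (n + 1) =>
        ∫ z in Ωstar Ω, (if k = 1 then z.1 else z.2) *
          (ev z (r n i) * ev z (r n j) * (z.1 * W00 W z))) * (Rmat n)⁻¹ =
      Jmat (n + 1) (2 * n + 2) 0 *
        (Lmat (2 * n + 1) k * Γp (2 * n + 1) k + Γp (2 * n) k * Lmat (2 * n) k) *
        (Jmat (n + 1) (2 * n + 2) 0)ᵀ) ∧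
    (∀ n : ℕ,
      (Matrix.of fun i j : Fin (n + 1) =>
        ∫ z in Ωstar Ω, (if k = 1 then z.1 else z.2) *
          (ev z (s n i) * ev z (s n j) * (z.2 * W00 W z))) * (Tmat n)⁻¹ =
      Jmat (n + 1) (2 * n + 2) 1 *
        (Lmat (2 * n + 1) k * Γp (2 * n + 1) k + Γp (2 * n) k * Lmat (2 * n) k) *
        (Jmat (n + 1) (2 * n + 2) 1)ᵀ) ∧
    (∀ m : ℕ,
      Rmat (m + 1) * (Lmat m k)ᵀ * (Rmat m)⁻¹ =
      Jmat (m + 2) (2 * m + 4) 0 * (Γp (2 * m + 2) k * Γp (2 * m + 1) k) *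
        (Jmat (m + 1) (2 * m + 2) 0)ᵀ) ∧
    (∀ m : ℕ,
      Tmat (m + 1) * (Lmat m k)ᵀ * (Tmat m)⁻¹ =
      Jmat (m + 2) (2 * m + 4) 1 * (Γp (2 * m + 2) k * Γp (2 * m + 1) k) *
        (Jmat (m + 1) (2 * m + 2) 1)ᵀ) := by
  have ht : ∀ c n j p, ev p (S (2 * n + 1) (interlace c j)) =
      ![p.1, p.2] c * ev (p.1 ^ 2, p.2 ^ 2) ((![r, s] : Fin 2 → _) c n j) := by
    intro c n j p
    fin_cases c
    · exact hrelr n j p.1 p.2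
    · exact hrels n j p.1 p.2
  rcases hk with rfl | rfl
  · have h0 := backlund_relations hW hsym hS hSmat hSdet hΓ ht 0 0 hRmat hRdet
    have h1 := backlund_relations hW hsym hS hSmat hSdet hΓ ht 1 0 hTmat hTdet
    exact ⟨h0.1, h1.1, h0.2, h1.2⟩
  · have h0 := backlund_relations hW hsym hS hSmat hSdet hΓ ht 0 1 hRmat hRdet
    have h1 := backlund_relations hW hsym hS hSmat hSdet hΓ ht 1 1 hTmat hTdet
    exact ⟨h0.1, h1.1, h0.2, h1.2⟩
end
end
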